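/- There exists an absolute constant c > 0 such that for all integers k ≥ 2 and n > k, for every n-point metric space M = (M,d) there is an initial configuration of k servers such that c·log k is a distributional lower bound for the k-server problem on M. Consequently, in every metric space with more than k points the randomized competitive ratio for the k-server problem is Ω(log k); this universal lower bound is asymptotically tight. -/

import Mathlib

open scoped Classical

/-- `d` is a metric on `M`. -/
def IsMetric {M : Type*} (d : M → M → ℝ) : Prop :=
  (∀ x y, d x y = 0 ↔ x = y) ∧ (∀ x y, d x y = d y x) ∧
    ∀ x y z, d x z ≤ d x y + d y z

/-- The cost of moving from configuration `S` to configuration `S'`: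
since a single step changes at most one server, the symmetric differences
have at most one element each and this is the distance moved. -/
noncomputable def kStepCost {M : Type*} (d : M → M → ℝ) (S S' : Finset M) : ℝ :=
  ∑ x ∈ S \ S', ∑ y ∈ S' \ S, d x y

/-- The configuration of the online algorithm `A` (with initial configuration
`S₀`) after serving the first `t` requests of `σ`. -/
def kConfig {M : Type*} (A : List M → Finset M) (S₀ : Finset M)
    (σ : List M) (t : ℕ) : Finset M :=
  if t = 0 then S₀ else A (σ.take t)

/-- `A` is a valid deterministic online `k`-server algorithm from `S₀`:
configurations have `k` servers, each request is covered as soon as it arrives,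
and at most one server moves per request. -/
def KServerAlg {M : Type*} (k : ℕ) (S₀ : Finset M) (A : List M → Finset M) : Prop :=
  ∀ (l : List M) (r : M),
    (A (l ++ [r])).card = k ∧ r ∈ A (l ++ [r]) ∧
      ((A (l ++ [r])) \ (if l = [] then S₀ else A l)).card ≤ 1

/-- Online cost of `A` on the request sequence `σ`. -/
noncomputable def kServerCost {M : Type*} (d : M → M → ℝ) (A : List M → Finset M)
    (S₀ : Finset M) (σ : List M) : ℝ :=
  ∑ t ∈ Finset.range σ.length,
    kStepCost d (kConfig A S₀ σ t) (kConfig A S₀ σ (t + 1))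

/-- `S` is a feasible (offline) schedule of `k` servers serving `σ` from `S₀`. -/
def KServerServes {M : Type*} (k : ℕ) (S₀ : Finset M) (σ : List M)
    (S : ℕ → Finset M) : Prop :=
  S 0 = S₀ ∧ ∀ (t : ℕ) (h : t < σ.length),
    (S (t + 1)).card = k ∧ σ.get ⟨t, h⟩ ∈ S (t + 1) ∧
      ((S (t + 1)) \ S t).card ≤ 1

/-- Optimal (offline) cost of serving `σ` from `S₀` with `k` servers. -/
noncomputable def kServerOpt {M : Type*} (d : M → M → ℝ) (k : ℕ) (S₀ : Finset M)
    (σ : List M) : ℝ :=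
  sInf {c | ∃ S : ℕ → Finset M, KServerServes k S₀ σ S ∧
    c = ∑ t ∈ Finset.range σ.length, kStepCost d (S t) (S (t + 1))}

/-- `C` is a distributional lower bound for the `k`-server problem on `(M,d)`
with initial configuration `S₀`. -/
def KServerDLB {M : Type*} (d : M → M → ℝ) (k : ℕ) (S₀ : Finset M) (C : ℝ) : Prop :=
  ∀ B : ℝ, 0 ≤ B → ∃ (N : ℕ) (P : Fin N → ℝ) (ρ : Fin N → List M),
    (∀ ω, 0 ≤ P ω) ∧ (∑ ω, P ω) = 1 ∧
    B ≤ (∑ ω, P ω * kServerOpt d k S₀ (ρ ω)) ∧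
    ∀ A : List M → Finset M, KServerAlg k S₀ A →
      C * (∑ ω, P ω * kServerOpt d k S₀ (ρ ω)) ≤
        ∑ ω, P ω * kServerCost d A S₀ (ρ ω)

universe u

/-- A finitely supported probability distribution, presented by a finite weighted index type. -/
structure FinDist (α : Type*) where
  ι : Type
  [fintype : Fintype ι]
  w : ι → ℝ
  val : ι → α
  nonneg : ∀ i, 0 ≤ w i
  sum_one : ∑ i, w i = 1

attribute [instance] FinDist.fintype

namespace FinDist

variable {α β : Type*}

/-- Expectation of a real function. -/
noncomputable def expect (D : FinDist α) (φ : α → ℝ) : ℝ := ∑ i, D.w i * φ (D.val i)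

/-- The point mass at `a`. -/
noncomputable def pure (a : α) : FinDist α where
  ι := Unit
  w := fun _ => 1
  val := fun _ => a
  nonneg := fun _ => zero_le_one
  sum_one := by simp

/-- Sequential composition. -/
noncomputable def bind (D : FinDist α) (K : α → FinDist β) : FinDist β where
  ι := Σ i : D.ι, (K (D.val i)).ι
  w := fun x => D.w x.1 * (K (D.val x.1)).w x.2
  val := fun x => (K (D.val x.1)).val x.2
  nonneg := fun x => mul_nonneg (D.nonneg _) ((K _).nonneg _)
  sum_one := by
    rw [Fintype.sum_sigma]
    simp [← Finset.mul_sum, FinDist.sum_one]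

/-- Push-forward. -/
noncomputable def map (h : α → β) (D : FinDist α) : FinDist β :=
  { D with val := fun i => h (D.val i) }

/-- The coin that is `true` with probability `p`. -/
noncomputable def bern (p : unitInterval) : FinDist Bool where
  ι := Bool
  w := fun b => if b then (p : ℝ) else 1 - p
  val := id
  nonneg := by
    rintro (_ | _)
    · simpa using p.2.2
    · simpa using p.2.1
  sum_one := by simp

/-- The uniform distribution on `{0, …, n}`. -/
noncomputable def unif (n : ℕ) : FinDist ℕ where
  ι := Fin (n + 1)
  w := fun _ => 1 / ((n : ℝ) + 1)
  val := fun i => i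
  nonneg := fun _ => by positivity
  sum_one := by
    have : (n : ℝ) + 1 ≠ 0 := by positivity
    simp [this]

@[simp] lemma expect_pure (a : α) (φ : α → ℝ) : (pure a).expect φ = φ a := by
  change ∑ _i : Unit, (1 : ℝ) * φ a = φ a
  simp

@[simp] lemma expect_bind (D : FinDist α) (K : α → FinDist β) (φ : β → ℝ) :
    (D.bind K).expect φ = D.expect fun a => (K a).expect φ := by
  change ∑ x : (Σ i : D.ι, (K (D.val i)).ι),
    D.w x.1 * (K (D.val x.1)).w x.2 * φ ((K (D.val x.1)).val x.2) = _
  rw [Fintype.sum_sigma]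
  simp [expect, Finset.mul_sum, mul_assoc]

@[simp] lemma expect_map (D : FinDist α) (h : α → β) (φ : β → ℝ) :
    (D.map h).expect φ = D.expect fun a => φ (h a) := rfl

@[simp] lemma expect_bern (p : unitInterval) (φ : Bool → ℝ) :
    (bern p).expect φ = p * φ true + (1 - p) * φ false := by
  change ∑ b : Bool, (if b then (p : ℝ) else 1 - p) * φ b = _
  simp

lemma expect_unif (n : ℕ) (φ : ℕ → ℝ) :
    (unif n).expect φ = (∑ i ∈ Finset.range (n + 1), φ i) / (n + 1) := by
  change ∑ i : Fin (n + 1), 1 / ((n : ℝ) + 1) * φ i = _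
  rw [← Finset.mul_sum, Fin.sum_univ_eq_sum_range (fun i => φ i)]
  ring

@[simp] lemma expect_const (D : FinDist α) (r : ℝ) : D.expect (fun _ => r) = r := by
  simp [expect, ← Finset.sum_mul, D.sum_one]

lemma expect_mono (D : FinDist α) {φ ψ : α → ℝ} (h : ∀ a, φ a ≤ ψ a) :
    D.expect φ ≤ D.expect ψ :=
  Finset.sum_le_sum fun i _ => mul_le_mul_of_nonneg_left (h _) (D.nonneg i)

lemma expect_add (D : FinDist α) (φ ψ : α → ℝ) :
    D.expect (fun a => φ a + ψ a) = D.expect φ + D.expect ψ := by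
  simp [expect, mul_add, Finset.sum_add_distrib]

lemma expect_const_mul (D : FinDist α) (r : ℝ) (φ : α → ℝ) :
    D.expect (fun a => r * φ a) = r * D.expect φ := by
  simp only [expect, Finset.mul_sum]
  exact Finset.sum_congr rfl fun i _ => by ring

lemma expect_sum (D : FinDist α) (s : Finset β) (φ : β → α → ℝ) :
    D.expect (fun a => ∑ b ∈ s, φ b a) = ∑ b ∈ s, D.expect (φ b) := by
  simp only [expect, Finset.mul_sum]
  exact Finset.sum_comm

lemma expect_comm (D : FinDist α) (E : FinDist β) (φ : α → β → ℝ) :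
    D.expect (fun a => E.expect fun b => φ a b) = E.expect fun b => D.expect fun a => φ a b := by
  simp only [expect, Finset.mul_sum]
  rw [Finset.sum_comm]
  exact Finset.sum_congr rfl fun i _ => Finset.sum_congr rfl fun j _ => by ring

end FinDist

/-- A randomized request generator: it issues soft tasks and tosses coins,
and finally returns a value. -/
inductive ReqTree (M : Type*) (α : Type*) where
  | ret (a : α) : ReqTree M α
  | task (y : M) (t : ReqTree M α) : ReqTree M α
  | coin (p : unitInterval) (t : Bool → ReqTree M α) : ReqTree M α

namespace ReqTree

variable {M α β : Type*}

/-- Sequential composition. -/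
noncomputable def bind : ReqTree M α → (α → ReqTree M β) → ReqTree M β
  | ret a, k => k a
  | task y t, k => task y (bind t k)
  | coin p t, k => coin p fun b => bind (t b) k

/-- `n` rounds of a state-dependent generator. -/
noncomputable def iter (step : α → ReqTree M α) : ℕ → α → ReqTree M α
  | 0, s => ret s
  | n + 1, s => bind (step s) (iter step n)

/-- The joint law of the issued tasks and the returned value. -/
noncomputable def law : ReqTree M α → FinDist (List M × α)
  | ret a => FinDist.pure ([], a)
  | task y t => (law t).map fun x => (y :: x.1, x.2)
  | coin p t => (FinDist.bern p).bind fun b => law (t b)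

lemma expect_law_bind (t : ReqTree M α) (k : α → ReqTree M β) (φ : List M × β → ℝ) :
    (law (bind t k)).expect φ =
      (law t).expect fun x => (law (k x.2)).expect fun z => φ (x.1 ++ z.1, z.2) := by
  induction t generalizing φ with
  | ret a => simp [bind, law]
  | task y t ih => simp [bind, law, ih]
  | coin p t ih => simp [bind, law, ih]

/-- A sequence with a new head. -/
def consF {β : Type*} (R : β) (F : ℕ → β) : ℕ → β
  | 0 => R
  | j + 1 => F j

/-- The task lists issued in `J` consecutive rounds. -/
noncomputable def rounds (step : α → ReqTree M α) : ℕ → α → FinDist (ℕ → List M)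
  | 0, _ => FinDist.pure fun _ => []
  | J + 1, s => (law (step s)).bind fun x => (rounds step J x.2).map (consF x.1)

section value

variable [MetricSpace M]

/-- The cost of the best response of an online player on the finite metric space `M`, started at
a point, when task `y` costs `c` at `y` and `f` is the terminal cost. -/
noncomputable def value (c : ℝ) : ReqTree M α → (α → M → ℝ) → M → ℝ
  | ret a, f => f a
  | task y t, f => fun x => ⨅ x', (dist x x' + (if x' = y then c else 0) + value c t f x')
  | coin p t, f => fun x => p * value c (t true) f x + (1 - p) * value c (t false) f x

lemma value_bind (c : ℝ) (t : ReqTree M α) (k : α → ReqTree M β) (f : β → M → ℝ) :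
    value c (bind t k) f = value c t fun a => value c (k a) f := by
  induction t with
  | ret a => rfl
  | task y t ih => simp only [bind, value, ih]
  | coin p t ih => simp only [bind, value, ih]

variable [Finite M] [Nonempty M]

lemma value_task_le (c : ℝ) (y : M) (t : ReqTree M α) (f : α → M → ℝ) (x x' : M) :
    value c (task y t) f x ≤ dist x x' + (if x' = y then c else 0) + value c t f x' :=
  ciInf_le (Set.finite_range _).bddBelow x'

lemma value_mono (c : ℝ) (t : ReqTree M α) {f f' : α → M → ℝ} (h : ∀ a x, f a x ≤ f' a x)
    (x : M) : value c t f x ≤ value c t f' x := by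
  induction t generalizing x with
  | ret a => exact h a x
  | task y t ih =>
    exact le_ciInf fun x' => (value_task_le c y t f x x').trans (by linarith [ih x'])
  | coin p t ih =>
    have h1 := mul_le_mul_of_nonneg_left (ih true x) p.2.1
    have h2 := mul_le_mul_of_nonneg_left (ih false x) (sub_nonneg.2 p.2.2)
    simp only [value]
    linarith

lemma value_lipschitz (c : ℝ) (t : ReqTree M α) {f : α → M → ℝ}
    (h : ∀ a x z, f a x ≤ f a z + dist x z) (x z : M) :
    value c t f x ≤ value c t f z + dist x z := by
  induction t generalizing x z with
  | ret a => exact h a x z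
  | task y t ih =>
    rw [← sub_le_iff_le_add]
    refine le_ciInf fun x' => ?_
    have := value_task_le c y t f x x'
    linarith [dist_triangle x z x']
  | coin p t ih =>
    have h1 := mul_le_mul_of_nonneg_left (ih true x z) p.2.1
    have h2 := mul_le_mul_of_nonneg_left (ih false x z) (sub_nonneg.2 p.2.2)
    simp only [value]
    linarith

/-- One round of `t` raises the value by `g` on `Y` for every terminal cost that is constant on
`Y` and separates `Y` from its complement by `Q`. -/
def Drift (c : ℝ) (Y : Finset M) (g Q : ℝ) (t : ReqTree M α) : Prop :=
  ∀ f : M → ℝ, (∀ x z, f x ≤ f z + dist x z) → (∀ x ∈ Y, ∀ y ∈ Y, f x = f y) →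
    (∀ x ∈ Y, ∀ z ∉ Y, f x + Q ≤ f z + dist x z) →
    ∀ x, f x + (if x ∈ Y then g else 0) ≤ value c t (fun _ => f) x

lemma drift_task {c : ℝ} (hc0 : 0 ≤ c) (y : M) (a : α) : Drift c {y} c c (task y (ret a)) := by
  intro f hl _ hg x
  refine le_ciInf fun x' => ?_
  have h1 := hl x x'
  simp only [Finset.mem_singleton, value] at hg ⊢
  by_cases hx : x = y
  · by_cases hx' : x' = y
    · simp only [hx, hx', if_true, dist_self]
      linarith
    · have := hg x hx x' hx'
      simp only [hx, hx', if_true, if_false] at this ⊢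
      linarith
  · by_cases hx' : x' = y
    · have := hg x' hx' x hx
      rw [dist_comm] at this
      simp only [hx, hx', if_true, if_false] at this h1 ⊢
      linarith
    · simp only [hx, hx', if_false]
      linarith

lemma drift_iter {c : ℝ} {Y : Finset M} {g Q Q' : ℝ} {step : α → ReqTree M α}
    (h : ∀ s, Drift c Y g Q (step s)) (hg : 0 ≤ g) (hgQ : g ≤ Q) (n : ℕ)
    (hQ : Q + n * g ≤ Q' + g) (s : α) : Drift c Y (n * g) Q' (iter step n s) := by
  intro f hl hc hgap
  induction n generalizing s with
  | zero => intro x; simp [iter, value]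
  | succ n ih =>
    intro x
    push_cast at hQ
    have hn : 0 ≤ n * g := by positivity
    have ih' := ih (by linarith)
    rw [iter, value_bind]
    have h1 : ∀ x z, f x + (if x ∈ Y then n * g else 0) ≤
        f z + (if z ∈ Y then n * g else 0) + dist x z := by
      intro x z
      have := hl x z
      by_cases hx : x ∈ Y <;> by_cases hz : z ∈ Y
      · simp only [hx, hz, if_true]; linarith
      · have := hgap x hx z hz
        simp only [hx, hz, if_true, if_false]; linarith
      · simp only [hx, hz, if_true, if_false]; linarith
      · simp only [hx, hz, if_false]; linarith
    have h2 := h s (fun x => f x + (if x ∈ Y then n * g else 0)) h1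
      (fun x hx y hy => by simp only [hx, hy, if_true, hc x hx y hy])
      (fun x hx z hz => by
        have := hgap x hx z hz
        simp only [hx, hz, if_true, if_false]; linarith) x
    refine le_trans (le_trans (le_of_eq ?_) h2) (value_mono c _ (fun a x => ih' a x) x)
    push_cast
    split_ifs <;> ring

end value

end ReqTree

section sequences

variable {β : Type*}

/-- The sequence `F` with all terms from index `J` on replaced by the empty list. -/
def trunc (J : ℕ) (F : ℕ → List β) (j : ℕ) : List β := if j < J then F j else []

/-- The sequence `F` without its first `u` terms. -/
def dropF (u : ℕ) (F : ℕ → β) (j : ℕ) : β := F (j + u)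

/-- The concatenation of the first `n` lists of `F`. -/
def cat : ℕ → (ℕ → List β) → List β
  | 0, _ => []
  | n + 1, F => F 0 ++ cat n fun j => F (j + 1)

/-- Two sequences combined into a family indexed by `Bool`. -/
def pairF {γ : Bool → Type*} (x : γ true) (y : γ false) : ∀ b, γ b
  | true => x
  | false => y

/-- Drops the first term of the sequence with index `b`. -/
noncomputable def shiftF (b : Bool) (F : Bool → ℕ → β) : Bool → ℕ → β :=
  Function.update F b fun j => F b (j + 1)

/-- Interleaves the two sequences of lists as prescribed by a list of coin tosses. -/
noncomputable def mrg : List Bool → (Bool → ℕ → List β) → ℕ → List β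
  | [], _ => fun _ => []
  | b :: bs, F => ReqTree.consF (F b 0) (mrg bs (shiftF b F))

lemma dropF_zero (F : ℕ → β) : dropF 0 F = F := rfl

lemma trunc_succ_consF (J : ℕ) (R : List β) (F : ℕ → List β) :
    trunc (J + 1) (ReqTree.consF R F) = ReqTree.consF R (trunc J F) := by
  funext j
  cases j <;> simp [trunc, ReqTree.consF]

lemma dropF_trunc (u J : ℕ) (F : ℕ → List β) :
    dropF u (trunc (u + J) F) = trunc J (dropF u F) := by
  funext j
  simp [trunc, dropF, add_comm u J]

lemma mem_cat {n : ℕ} {F : ℕ → List β} {y : β} (h : y ∈ cat n F) : ∃ j, y ∈ F j := by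
  induction n generalizing F with
  | zero => simp [cat] at h
  | succ n ih =>
    rcases List.mem_append.1 h with h | h
    · exact ⟨0, h⟩
    · obtain ⟨j, hj⟩ := ih h
      exact ⟨j + 1, hj⟩

lemma mem_trunc {J j : ℕ} {F : ℕ → List β} {y : β} (h : y ∈ trunc J F j) : y ∈ F j := by
  unfold trunc at h
  split_ifs at h
  · exact h
  · simp at h

lemma mem_mrg {bs : List Bool} {F : Bool → ℕ → List β} {y : β} {j : ℕ}
    (h : y ∈ mrg bs F j) : ∃ b i, y ∈ F b i := by
  induction bs generalizing F j with
  | nil => simp [mrg] at h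
  | cons b bs ih =>
    cases j with
    | zero => exact ⟨b, 0, h⟩
    | succ j =>
      obtain ⟨b', i, hi⟩ := ih h
      by_cases hb : b' = b
      · subst hb
        exact ⟨b', i + 1, by simpa [shiftF] using hi⟩
      · exact ⟨b', i, by simpa [shiftF, hb] using hi⟩

end sequences

namespace ReqTree

variable {M α : Type*}

lemma rounds_trunc (step : α → ReqTree M α) {J n : ℕ} (h : J ≤ n) (s : α)
    (φ : (ℕ → List M) → ℝ) :
    (rounds step J s).expect φ = (rounds step n s).expect fun F => φ (trunc J F) := by
  induction J generalizing n s φ with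
  | zero =>
    have : ∀ F : ℕ → List M, trunc 0 F = fun _ => [] := fun F => by funext j; simp [trunc]
    simp [rounds, this]
  | succ J ih =>
    obtain ⟨n, rfl⟩ : ∃ m, n = m + 1 := ⟨n - 1, by omega⟩
    simp only [rounds, FinDist.expect_bind, FinDist.expect_map, trunc_succ_consF]
    congr 1
    funext x
    exact ih (by omega) x.2 fun F => φ (consF x.1 F)

lemma rounds_add (step : α → ReqTree M α) (m n : ℕ) (s : α)
    (ψ : List M → (ℕ → List M) → ℝ) :
    ((law (iter step m s)).expect fun x => (rounds step n x.2).expect fun F => ψ x.1 F) =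
      (rounds step (n + m) s).expect fun F => ψ (cat m F) (dropF m F) := by
  induction m generalizing s ψ with
  | zero => simp [iter, law, cat, dropF_zero]
  | succ m ih =>
    simp only [iter, expect_law_bind]
    rw [← add_assoc]
    simp only [rounds, FinDist.expect_bind, FinDist.expect_map]
    congr 1
    funext x
    exact ih x.2 fun R F => ψ (x.1 ++ R) F

lemma rounds_iter (step : α → ReqTree M α) (m J : ℕ) (s : α) (φ : (ℕ → List M) → ℝ) :
    (rounds (iter step m) J s).expect φ = (rounds step (m * J) s).expect fun F =>
      φ (trunc J fun j => cat m (dropF (m * j) F)) := by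
  induction J generalizing s φ with
  | zero =>
    have : ∀ F : ℕ → List M, trunc 0 F = fun _ => [] := fun F => by funext j; simp [trunc]
    simp [rounds, this]
  | succ J ih =>
    simp only [rounds, FinDist.expect_bind, FinDist.expect_map, ih]
    rw [rounds_add step m (m * J) s fun R F =>
      φ (consF R (trunc J fun j => cat m (dropF (m * j) F))), mul_add, mul_one]
    congr 1
    funext F
    congr 1
    funext j
    cases j with
    | zero => simp [consF, trunc, dropF_zero]
    | succ j =>
      have : dropF (m * j) (dropF m F) = dropF (m * (j + 1)) F := by
        funext i
        simp only [dropF]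
        congr 1
        ring
      simp [consF, trunc, this]

/-- A list of `n` independent coin tosses. -/
noncomputable def coins (p : unitInterval) : ℕ → FinDist (List Bool)
  | 0 => FinDist.pure []
  | n + 1 => (FinDist.bern p).bind fun b => (coins p n).map fun bs => b :: bs

lemma expect_coins_mono (p : unitInterval) (n : ℕ) {φ ψ : List Bool → ℝ}
    (h : ∀ bs : List Bool, bs.length = n → φ bs ≤ ψ bs) :
    (coins p n).expect φ ≤ (coins p n).expect ψ := by
  induction n generalizing φ ψ with
  | zero => simpa [coins] using h [] rfl
  | succ n ih =>
    simp only [coins, FinDist.expect_bind, FinDist.expect_map]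
    exact FinDist.expect_mono _ fun b => ih fun bs hbs => h _ (by simp [hbs])

/-- Tosses a coin and performs a round of the generator selected by it. -/
noncomputable def mixStep (p : unitInterval) {S : Bool → Type*}
    (step : ∀ b, S b → ReqTree M (S b)) (s : ∀ b, S b) : ReqTree M (∀ b, S b) :=
  coin p fun b => bind (step b (s b)) fun s' => ret (Function.update s b s')

lemma rounds_mixStep (p : unitInterval) {S : Bool → Type*}
    (step : ∀ b, S b → ReqTree M (S b)) {J m n : ℕ} (hm : J ≤ m) (hn : J ≤ n) (s : ∀ b, S b)
    (φ : (ℕ → List M) → ℝ) :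
    (rounds (mixStep p step) J s).expect φ = (coins p J).expect fun bs =>
      (rounds (step true) m (s true)).expect fun F₁ =>
        (rounds (step false) n (s false)).expect fun F₂ => φ (mrg bs (pairF F₁ F₂)) := by
  induction J generalizing m n s φ with
  | zero => simp [rounds, coins, mrg]
  | succ J ih =>
    simp only [rounds, coins, mixStep, law, FinDist.expect_bind, FinDist.expect_map,
      expect_law_bind, FinDist.expect_pure, List.append_nil] at ih ⊢
    congr 1
    funext b
    cases b with
    | true =>
      obtain ⟨m, rfl⟩ : ∃ m', m = m' + 1 := ⟨m - 1, by omega⟩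
      simp only [rounds, FinDist.expect_bind, FinDist.expect_map]
      rw [FinDist.expect_comm]
      congr 1
      funext x
      rw [ih (m := m) (n := n) (by omega) (by omega)]
      have h : ∀ F₁ F₂, shiftF true (pairF (consF x.1 F₁) F₂) = pairF F₁ F₂ := fun F₁ F₂ => by
        funext b
        cases b <;> rfl
      simp only [mrg, h]
      rfl
    | false =>
      obtain ⟨n, rfl⟩ : ∃ n', n = n' + 1 := ⟨n - 1, by omega⟩
      simp only [rounds, FinDist.expect_bind, FinDist.expect_map]
      have h : ∀ (R : List M) F₁ F₂,
          shiftF false (pairF F₁ (consF R F₂)) = pairF F₁ F₂ := fun R F₁ F₂ => by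
        funext b
        cases b <;> rfl
      simp only [mrg, h]
      have h2 : ∀ bs : List Bool, ((rounds (step true) m (s true)).expect fun F₁ =>
          (law (step false (s false))).expect fun x => (rounds (step false) n x.2).expect fun F₂ =>
            φ (consF (pairF (γ := fun _ => ℕ → List M) F₁ (consF x.1 F₂) false 0)
              (mrg bs (pairF F₁ F₂)))) =
          (law (step false (s false))).expect fun x => (rounds (step true) m (s true)).expect
            fun F₁ => (rounds (step false) n x.2).expect fun F₂ =>
              φ (consF x.1 (mrg bs (pairF F₁ F₂))) := fun bs =>
        FinDist.expect_comm _ _ _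
      simp only [h2]
      rw [FinDist.expect_comm]
      congr 1
      funext x
      rw [ih (m := m) (n := n) (by omega) (by omega)]
      rfl

end ReqTree

section offline

variable {M : Type*} [MetricSpace M]

/-- The cheapest way of moving from `a` to `b` while processing the soft tasks in a list. -/
noncomputable def off (c : ℝ) : List M → M → M → ℝ
  | [], a, b => dist a b
  | y :: R, a, b => ⨅ x, (dist a x + (if x = y then c else 0) + off c R x b)

variable [Finite M]

lemma off_cons_le (c : ℝ) (y : M) (R : List M) (a b x : M) :
    off c (y :: R) a b ≤ dist a x + (if x = y then c else 0) + off c R x b :=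
  ciInf_le (Set.finite_range _).bddBelow x

lemma off_append_le [Nonempty M] (c : ℝ) (R R' : List M) (a b e : M) :
    off c (R ++ R') a e ≤ off c R a b + off c R' b e := by
  induction R generalizing a with
  | nil =>
    cases R' with
    | nil => exact dist_triangle a b e
    | cons y R' =>
      rw [List.nil_append, ← sub_le_iff_le_add']
      refine le_ciInf fun x => ?_
      have := off_cons_le c y R' a e x
      simp only [off] at this ⊢
      linarith [dist_triangle a b x]
  | cons y R ih =>
    rw [← sub_le_iff_le_add]
    refine le_ciInf fun x => ?_
    have := off_cons_le c y (R ++ R') a e x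
    rw [List.cons_append]
    linarith [ih x]

lemma off_self_le (c : ℝ) {R : List M} {a : M} (h : a ∉ R) : off c R a a ≤ 0 := by
  induction R with
  | nil => simp [off]
  | cons y R ih =>
    rw [List.mem_cons, not_or] at h
    have := off_cons_le c y R a a a
    rw [dist_self, if_neg h.1] at this
    linarith [ih h.2]

lemma off_le_dist_add [Nonempty M] (c : ℝ) (R : List M) (a x b : M) :
    off c R a b ≤ dist a x + off c R x b :=
  off_append_le c [] R a x b

lemma off_nonneg [Nonempty M] {c : ℝ} (hc : 0 ≤ c) (R : List M) (a b : M) :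
    0 ≤ off c R a b := by
  induction R generalizing a with
  | nil => exact dist_nonneg
  | cons y R ih =>
    refine le_ciInf fun x => ?_
    have := ih x
    split_ifs <;> positivity

lemma off_cat_le [Nonempty M] (c : ℝ) (n : ℕ) (F : ℕ → List M) (q : ℕ → M) :
    off c (cat n F) (q 0) (q n) ≤ ∑ i ∈ Finset.range n, off c (F i) (q i) (q (i + 1)) := by
  induction n generalizing F q with
  | zero => simp [cat, off]
  | succ n ih =>
    rw [Finset.sum_range_succ']
    have h1 := off_append_le c (F 0) (cat n fun j => F (j + 1)) (q 0) (q 1) (q (n + 1))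
    have h2 := ih (fun j => F (j + 1)) fun j => q (j + 1)
    simp only [zero_add] at h2 ⊢
    rw [cat]
    linarith

end offline

section strategies

variable {M : Type u} [MetricSpace M] [Finite M] [Nonempty M]

/-- The random task lists `R` can be processed by moving along the points `q` of `Y`, at expected
cost at most `r` for each of the first `n` lists. -/
def Follows (c : ℝ) (Y : Finset M) (r : ℝ) (n : ℕ) {α : Type} (D : FinDist α)
    (R : α → ℕ → List M) (q : α → ℕ → M) : Prop :=
  (∀ ω j, q ω j ∈ Y) ∧ (∀ ω j, ∀ y ∈ R ω j, y ∈ Y) ∧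
    ∀ j < n, (D.expect fun ω => off c (R ω j) (q ω j) (q ω (j + 1))) ≤ r

/-- There is a generator of tasks in `Y` whose rounds raise the value by `g`, while they can be
processed offline at cost `r` per round. -/
def Good (c : ℝ) (Y : Finset M) (g Q r : ℝ) : Prop :=
  ∃ (S : Type) (step : S → ReqTree M S), (∀ s, ReqTree.Drift c Y g Q (step s)) ∧
    ∀ J : ℕ, ∃ (init : FinDist S) (α : Type) (D : FinDist α) (R : α → ℕ → List M)
      (q : α → ℕ → M),
      (∀ φ : (ℕ → List M) → ℝ,
        (init.expect fun s => (ReqTree.rounds step J s).expect φ) = D.expect fun ω => φ (R ω)) ∧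
      Follows c Y r J D R q

lemma good_singleton {c : ℝ} (hc : 0 ≤ c) (y : M) : Good c {y} c c c := by
  refine ⟨Unit, fun _ => .task y (.ret ()), fun _ => ReqTree.drift_task hc y (), fun J => ?_⟩
  refine ⟨FinDist.pure (), Unit, FinDist.pure (), fun _ => trunc J fun _ => [y], fun _ _ => y,
    fun φ => ?_, fun _ _ => by simp, fun _ j z hz => ?_, fun j hj => ?_⟩
  · have : ∀ J, ∀ φ : (ℕ → List M) → ℝ, (ReqTree.rounds (fun _ : Unit =>
        ReqTree.task y (.ret ())) J ()).expect φ = φ (trunc J fun _ => [y]) := by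
      intro J
      induction J with
      | zero =>
        intro φ
        have : (trunc 0 fun _ => [y]) = fun _ => [] := by funext j; simp [trunc]
        simp [ReqTree.rounds, this]
      | succ J ih =>
        intro φ
        have h : (fun _ => [y] : ℕ → List M) = ReqTree.consF [y] fun _ => [y] := by
          funext j; cases j <;> rfl
        rw [h, trunc_succ_consF]
        simp only [ReqTree.rounds, ReqTree.law, FinDist.expect_bind, FinDist.expect_map,
          FinDist.expect_pure, ih]
    simp only [FinDist.expect_pure, this]
  · simpa using mem_trunc hz
  · have h := off_cons_le c y [] y y y
    simp only [FinDist.expect_pure, trunc, hj, if_true]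
    simpa [off] using h

lemma Good.iter {c : ℝ} {Y : Finset M} {g Q r : ℝ} (h : Good c Y g Q r) (hg : 0 ≤ g)
    (hgQ : g ≤ Q) (n : ℕ) {Q' : ℝ} (hQ : Q + n * g ≤ Q' + g) :
    Good c Y (n * g) Q' (n * r) := by
  obtain ⟨S, step, hd, hJ⟩ := h
  refine ⟨S, ReqTree.iter step n, ReqTree.drift_iter hd hg hgQ n hQ, fun J => ?_⟩
  obtain ⟨init, α, D, R, q, hlaw, hq, hR, hr⟩ := hJ (n * J)
  refine ⟨init, α, D, fun ω => trunc J fun j => cat n (dropF (n * j) (R ω)),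
    fun ω j => q ω (n * j), fun φ => ?_, fun ω j => hq _ _, fun ω j y hy => ?_, fun j hj => ?_⟩
  · simp only [ReqTree.rounds_iter]
    exact hlaw fun F => φ (trunc J fun j => cat n (dropF (n * j) F))
  · obtain ⟨i, hi⟩ := mem_cat (mem_trunc hy)
    exact hR _ _ y hi
  · simp only [trunc, hj, if_true]
    calc D.expect (fun ω => off c (cat n (dropF (n * j) (R ω))) (q ω (n * j))
            (q ω (n * (j + 1))))
        ≤ D.expect (fun ω => ∑ i ∈ Finset.range n, off c (R ω (i + n * j)) (q ω (i + n * j))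
            (q ω (i + n * j + 1))) := FinDist.expect_mono _ fun ω => by
          have := off_cat_le c n (dropF (n * j) (R ω)) (dropF (n * j) (q ω))
          simp only [dropF, zero_add, add_right_comm _ 1 (n * j)] at this
          rwa [show n * (j + 1) = n + n * j by ring]
      _ = ∑ i ∈ Finset.range n, D.expect fun ω => off c (R ω (i + n * j)) (q ω (i + n * j))
            (q ω (i + n * j + 1)) := FinDist.expect_sum _ _ _
      _ ≤ ∑ i ∈ Finset.range n, r := by
          refine Finset.sum_le_sum fun i hi => hr _ ?_
          have := Finset.mem_range.1 hi
          calc i + n * j < n + n * j := by omega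
            _ = n * (j + 1) := by ring
            _ ≤ n * J := Nat.mul_le_mul_left n hj
      _ = n * r := by simp

/-- The cost of the offline player deciding between two strategies, where processing a list with
index `b` costs `ℓ b` and changing the strategy costs `Γ`. -/
noncomputable def choiceCost (ℓ : Bool → ℝ) (Γ : ℝ) : List Bool → Bool → ℝ
  | [], _ => 0
  | b :: bs, a => min (choiceCost ℓ Γ bs a + if a = b then ℓ b else 0)
      (choiceCost ℓ Γ bs (!a) + (if (!a) = b then ℓ b else 0) + Γ)

/-- The optimal strategy in `choiceCost` after the first toss. -/
noncomputable def nextChoice (ℓ : Bool → ℝ) (Γ : ℝ) (b : Bool) (bs : List Bool) (a : Bool) : Bool :=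
  if choiceCost ℓ Γ bs a + (if a = b then ℓ b else 0) ≤
    choiceCost ℓ Γ bs (!a) + (if (!a) = b then ℓ b else 0) + Γ then a else !a

/-- The points visited by the optimal strategy. -/
noncomputable def mrgPos (ℓ : Bool → ℝ) (Γ : ℝ) :
    List Bool → Bool → (Bool → ℕ → M) → ℕ → M
  | [], a, q => fun _ => q a 0
  | b :: bs, a, q => ReqTree.consF (q a 0) (mrgPos ℓ Γ bs (nextChoice ℓ Γ b bs a) (shiftF b q))

lemma choiceCost_cons (ℓ : Bool → ℝ) (Γ : ℝ) (b : Bool) (bs : List Bool) (a : Bool) :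
    choiceCost ℓ Γ (b :: bs) a = choiceCost ℓ Γ bs (nextChoice ℓ Γ b bs a) +
      (if nextChoice ℓ Γ b bs a = b then ℓ b else 0) +
      if nextChoice ℓ Γ b bs a = a then 0 else Γ := by
  rw [choiceCost, nextChoice]
  split_ifs with h <;> simp_all
  all_goals linarith

lemma mrgPos_zero (ℓ : Bool → ℝ) (Γ : ℝ) (bs : List Bool) (a : Bool) (q : Bool → ℕ → M) :
    mrgPos ℓ Γ bs a q 0 = q a 0 := by
  cases bs <;> rfl

lemma mrgPos_mem {ℓ : Bool → ℝ} {Γ : ℝ} {bs : List Bool} {a : Bool} {q : Bool → ℕ → M}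
    {Y : Set M} (h : ∀ b i, q b i ∈ Y) (j : ℕ) : mrgPos ℓ Γ bs a q j ∈ Y := by
  induction bs generalizing a q j with
  | nil => exact h _ _
  | cons b bs ih =>
    cases j with
    | zero => exact h _ _
    | succ j =>
      refine ih (fun b' i => ?_) j
      by_cases hb : b' = b
      · subst hb; simpa [shiftF] using h _ _
      · simpa [shiftF, hb] using h _ _

lemma sum_off_mrg_le {c Γ : ℝ} {ℓ : Bool → ℝ} {Y : Bool → Finset M} {α : Type} (D : FinDist α)
    {F : α → Bool → ℕ → List M} {q : α → Bool → ℕ → M} {n : ℕ}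
    (hY : Disjoint (Y true) (Y false))
    (hΓ : ∀ b b', ∀ x ∈ Y b, ∀ y ∈ Y b', dist x y ≤ Γ) (bs : List Bool) (hbs : bs.length ≤ n)
    (h : ∀ b, Follows c (Y b) (ℓ b) n D (fun ω => F ω b) fun ω => q ω b) (a : Bool) :
    ∑ j ∈ Finset.range bs.length, (D.expect fun ω => off c (mrg bs (F ω) j)
      (mrgPos ℓ Γ bs a (q ω) j) (mrgPos ℓ Γ bs a (q ω) (j + 1))) ≤ choiceCost ℓ Γ bs a := by
  induction bs generalizing a F q n with
  | nil => simp [choiceCost]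
  | cons b bs ih =>
    rw [List.length_cons] at hbs ⊢
    obtain ⟨n, rfl⟩ : ∃ m, n = m + 1 := ⟨n - 1, by omega⟩
    have hdisj : ∀ b b', b ≠ b' → ∀ x ∈ Y b, x ∉ Y b' := by
      intro b b' hbb x hx hx'
      rw [Finset.disjoint_left] at hY
      cases b <;> cases b' <;> first | exact hbb rfl | exact hY hx hx' | exact hY hx' hx
    have hs : ∀ b', Follows c (Y b') (ℓ b') n D (fun ω => shiftF b (F ω) b')
        fun ω => shiftF b (q ω) b' := by
      intro b'
      obtain ⟨h1, h2, h3⟩ := h b'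
      by_cases hb : b' = b
      · subst hb
        simp only [shiftF, Function.update_self]
        exact ⟨fun ω j => h1 _ _, fun ω j => h2 _ _, fun j hj => h3 _ (by omega)⟩
      · simp only [shiftF, Function.update_of_ne hb]
        exact ⟨h1, h2, fun j hj => h3 _ (by omega)⟩
    rw [Finset.sum_range_succ', choiceCost_cons]
    have h1 := ih (by omega) hs (nextChoice ℓ Γ b bs a)
    simp only [mrg, mrgPos, ReqTree.consF, mrgPos_zero]
    rw [add_assoc]
    refine add_le_add h1 ?_
    generalize nextChoice ℓ Γ b bs a = a'
    by_cases hb : a' = b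
    · subst hb
      simp only [shiftF, Function.update_self, zero_add, if_true]
      have h3 := (h a').2.2 0 (by omega)
      by_cases ha : a' = a
      · subst ha
        simpa using h3
      · rw [if_neg ha]
        calc _ ≤ D.expect fun ω => off c (F ω a' 0) (q ω a' 0) (q ω a' 1) + Γ :=
              FinDist.expect_mono _ fun ω => by
                have := off_le_dist_add c (F ω a' 0) (q ω a 0) (q ω a' 0) (q ω a' 1)
                linarith [hΓ a a' _ ((h a).1 ω 0) _ ((h a').1 ω 0)]
          _ ≤ _ := by
                rw [FinDist.expect_add, FinDist.expect_const]
                simpa using h3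
    · simp only [shiftF, Function.update_of_ne hb, if_neg hb, zero_add]
      rw [← FinDist.expect_const D (if a' = a then 0 else Γ)]
      refine FinDist.expect_mono _ fun ω => ?_
      have hn : q ω a' 0 ∉ F ω b 0 := fun hm =>
        hdisj a' b hb _ ((h a').1 ω 0) ((h b).2.1 ω 0 _ hm)
      by_cases ha : a' = a
      · subst ha
        simpa using off_self_le c hn
      · have h4 := off_le_dist_add c (F ω b 0) (q ω a 0) (q ω a' 0) (q ω a' 0)
        rw [if_neg ha]
        linarith [hΓ a a' _ ((h a).1 ω 0) _ ((h a').1 ω 0), off_self_le c hn]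

end strategies

section mixing

variable {M : Type u} [MetricSpace M] [Finite M] [Nonempty M]

lemma ReqTree.drift_mixStep {c g : ℝ} {p : unitInterval} {Y : Bool → Finset M} {G Q : Bool → ℝ}
    {S : Bool → Type} {step : ∀ b, S b → ReqTree M (S b)}
    (h : ∀ b s, ReqTree.Drift c (Y b) (G b) (Q b) (step b s))
    (hY : Disjoint (Y true) (Y false)) (hsep : ∀ b, ∀ x ∈ Y true, ∀ y ∈ Y false, Q b ≤ dist x y)
    (h₁ : p * G true = g) (h₂ : (1 - p) * G false = g) (s : ∀ b, S b) :
    ReqTree.Drift c (Y true ∪ Y false) g (max (Q true) (Q false)) (ReqTree.mixStep p step s) := by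
  intro f hl hc hgap x
  have hsep' : ∀ b, ∀ x ∈ Y b, ∀ y ∈ Y (!b), Q b ≤ dist x y := by
    rintro (_ | _) x hx y hy
    · rw [dist_comm]; exact hsep _ y hy x hx
    · exact hsep _ x hx y hy
  have hsub : ∀ b, ∀ x ∈ Y b, x ∈ Y true ∪ Y false := by
    rintro (_ | _) x hx <;> simp [hx]
  have hQ : ∀ b, Q b ≤ max (Q true) (Q false) := by
    rintro (_ | _) <;> simp
  have key : ∀ b, f x + (if x ∈ Y b then G b else 0) ≤
      ReqTree.value c (step b (s b)) (fun _ => f) x := by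
    intro b
    refine h b (s b) f hl (fun x hx y hy => hc x (hsub b x hx) y (hsub b y hy))
      (fun x hx z hz => ?_) x
    by_cases hz' : z ∈ Y (!b)
    · rw [hc x (hsub b x hx) z (hsub _ z hz')]
      linarith [hsep' b x hx z hz']
    · have hzu : z ∉ Y true ∪ Y false := by
        cases b <;> simp_all
      linarith [hgap x (hsub b x hx) z hzu, hQ b]
  have k1 := mul_le_mul_of_nonneg_left (key true) p.2.1
  have k2 := mul_le_mul_of_nonneg_left (key false) (sub_nonneg.2 p.2.2)
  simp only [ReqTree.mixStep, ReqTree.value, ReqTree.value_bind]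
  refine le_trans ?_ (add_le_add k1 k2)
  rw [Finset.disjoint_left] at hY
  by_cases hx : x ∈ Y true
  · simp only [Finset.mem_union, hx, hY hx, true_or, if_true, if_false]
    linarith
  · by_cases hx' : x ∈ Y false
    · simp only [Finset.mem_union, hx, hx', or_true, if_true, if_false]
      linarith
    · simp only [Finset.mem_union, hx, hx', or_self, if_false]
      linarith

lemma Good.mix {c g r Γ : ℝ} (hc : 0 ≤ c) {p : unitInterval} {Y : Bool → Finset M}
    {G Q ℓ : Bool → ℝ} (h : ∀ b, Good c (Y b) (G b) (Q b) (ℓ b))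
    (hY : Disjoint (Y true) (Y false)) (hsep : ∀ b, ∀ x ∈ Y true, ∀ y ∈ Y false, Q b ≤ dist x y)
    (hΓ : ∀ b b', ∀ x ∈ Y b, ∀ y ∈ Y b', dist x y ≤ Γ)
    (h₁ : p * G true = g) (h₂ : (1 - p) * G false = g)
    (hr : ∀ J : ℕ, ∃ P : ℕ,
      ((ReqTree.coins p (P + J)).expect fun bs => choiceCost ℓ Γ bs true) ≤ (P + 1) * r) :
    Good c (Y true ∪ Y false) g (max (Q true) (Q false)) r := by
  choose S step hd hJ using h
  refine ⟨∀ b, S b, ReqTree.mixStep p step, ReqTree.drift_mixStep hd hY hsep h₁ h₂, fun J => ?_⟩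
  obtain ⟨P, hP⟩ := hr J
  have hJ' := fun b => hJ b (P + J)
  choose init α D R q hlaw hfol using hJ'
  have hsub : ∀ b, ∀ x ∈ Y b, x ∈ Y true ∪ Y false := by
    rintro (_ | _) x hx <;> simp [hx]
  let prod : FinDist (α true × α false) :=
    (D true).bind fun a => (D false).map fun b => (a, b)
  let F : α true × α false → Bool → ℕ → List M := fun ω =>
    pairF (R true ω.1) (R false ω.2)
  let pos : α true × α false → Bool → ℕ → M := fun ω =>
    pairF (q true ω.1) (q false ω.2)
  refine ⟨(FinDist.unif P).bind fun n => (init true).bind fun s₁ => (init false).bind fun s₂ =>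
      (ReqTree.iter (ReqTree.mixStep p step) n (pairF s₁ s₂)).law.map Prod.snd,
    ℕ × List Bool × α true × α false,
    (FinDist.unif P).bind fun n => (ReqTree.coins p (P + J)).bind fun bs =>
      prod.map fun ω => (n, bs, ω),
    fun ω => trunc J (dropF ω.1 (mrg ω.2.1 (F ω.2.2))),
    fun ω j => mrgPos ℓ Γ ω.2.1 true (pos ω.2.2) (j + ω.1), fun φ => ?_, fun ω j => ?_,
    fun ω j y hy => ?_, fun j hj => ?_⟩
  · simp only [FinDist.expect_bind, FinDist.expect_map, FinDist.expect_unif, prod]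
    congr 1
    refine Finset.sum_congr rfl fun n hn => ?_
    have hn' : n ≤ P := Nat.lt_succ_iff.1 (Finset.mem_range.1 hn)
    have h1 : ∀ s, ((ReqTree.iter (ReqTree.mixStep p step) n s).law.expect fun x =>
        (ReqTree.rounds (ReqTree.mixStep p step) J x.2).expect φ) =
        (ReqTree.coins p (P + J)).expect fun bs =>
          (ReqTree.rounds (step true) (P + J) (s true)).expect fun F₁ =>
            (ReqTree.rounds (step false) (P + J) (s false)).expect fun F₂ =>
              φ (trunc J (dropF n (mrg bs (pairF F₁ F₂)))) := by
      intro s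
      rw [ReqTree.rounds_add _ n J s fun _ F => φ F,
        ReqTree.rounds_trunc _ (show J + n ≤ P + J by omega),
        ReqTree.rounds_mixStep p step le_rfl le_rfl]
      simp only [add_comm J n, dropF_trunc]
    simp only [h1, pairF]
    have h2 : ∀ (bs : List Bool), ((init true).expect fun s₁ => (init false).expect fun s₂ =>
        (ReqTree.rounds (step true) (P + J) s₁).expect fun F₁ =>
            (ReqTree.rounds (step false) (P + J) s₂).expect fun F₂ =>
              φ (trunc J (dropF n (mrg bs (pairF F₁ F₂))))) =
        (D true).expect fun a => (D false).expect fun b =>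
          φ (trunc J (dropF n (mrg bs (F (a, b))))) := by
      intro bs
      calc _ = (init true).expect fun s₁ => (ReqTree.rounds (step true) (P + J) s₁).expect
            fun F₁ => (init false).expect fun s₂ =>
            (ReqTree.rounds (step false) (P + J) s₂).expect fun F₂ =>
              φ (trunc J (dropF n (mrg bs (pairF F₁ F₂)))) := by
            congr 1
            funext s₁
            exact FinDist.expect_comm _ _ _
        _ = (init true).expect fun s₁ => (ReqTree.rounds (step true) (P + J) s₁).expect
            fun F₁ => (D false).expect fun b =>
              φ (trunc J (dropF n (mrg bs (pairF F₁ (R false b))))) := by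
            congr 1
            funext s₁
            congr 1
            funext F₁
            exact hlaw false fun F₂ => φ (trunc J (dropF n (mrg bs (pairF F₁ F₂))))
        _ = _ := hlaw true fun F₁ => (D false).expect fun b =>
              φ (trunc J (dropF n (mrg bs (pairF F₁ (R false b)))))
    simp only [← h2]
    rw [FinDist.expect_comm (ReqTree.coins p (P + J)) (init true)]
    congr 1
    funext s₁
    rw [FinDist.expect_comm (ReqTree.coins p (P + J)) (init false)]
  · refine mrgPos_mem (Y := (↑(Y true ∪ Y false) : Set M)) (fun b i => ?_) _
    rw [Finset.mem_coe]
    cases b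
    · exact hsub _ _ ((hfol false).1 _ _)
    · exact hsub _ _ ((hfol true).1 _ _)
  · obtain ⟨b, i, hi⟩ := mem_mrg (j := j + ω.1)
      (mem_trunc (F := dropF ω.1 (mrg ω.2.1 (F ω.2.2))) hy)
    cases b
    · exact hsub _ _ ((hfol false).2.1 _ _ _ hi)
    · exact hsub _ _ ((hfol true).2.1 _ _ _ hi)
  · have hfol' : ∀ b, Follows c (Y b) (ℓ b) (P + J) prod (fun ω => F ω b) fun ω => pos ω b := by
      rintro (_ | _)
      · refine ⟨fun ω => (hfol false).1 _, fun ω => (hfol false).2.1 _, fun j hj => ?_⟩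
        simp only [prod, FinDist.expect_bind, FinDist.expect_map, F, pos, pairF,
          FinDist.expect_const]
        exact (hfol false).2.2 j hj
      · refine ⟨fun ω => (hfol true).1 _, fun ω => (hfol true).2.1 _, fun j hj => ?_⟩
        simp only [prod, FinDist.expect_bind, FinDist.expect_map, F, pos, pairF,
          FinDist.expect_const]
        exact (hfol true).2.2 j hj
    have hP1 : (0 : ℝ) < P + 1 := by positivity
    simp only [FinDist.expect_bind, FinDist.expect_map, FinDist.expect_unif, trunc, hj, if_true,
      dropF]
    rw [div_le_iff₀ hP1, mul_comm r, ← FinDist.expect_sum]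
    refine le_trans (ReqTree.expect_coins_mono _ _ fun bs hbs => ?_) hP
    refine le_trans ?_ (sum_off_mrg_le (c := c) prod hY hΓ bs hbs.le hfol' true)
    rw [hbs]
    set X : ℕ → ℝ := fun i => prod.expect fun ω => off c (mrg bs (F ω) i)
      (mrgPos ℓ Γ bs true (pos ω) i) (mrgPos ℓ Γ bs true (pos ω) (i + 1)) with hX
    have hX0 : ∀ i, 0 ≤ X i := fun i => by
      rw [← FinDist.expect_const prod 0]
      exact FinDist.expect_mono _ fun ω => off_nonneg hc _ _ _
    calc _ = ∑ i ∈ Finset.range (P + 1), X (j + i) := by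
          refine Finset.sum_congr rfl fun i _ => ?_
          simp only [hX, add_right_comm j 1 i]
      _ = ∑ i ∈ (Finset.range (P + 1)).map (addLeftEmbedding j), X i := by
          rw [Finset.sum_map]; rfl
      _ ≤ ∑ i ∈ Finset.range (P + J), X i := by
          refine Finset.sum_le_sum_of_subset_of_nonneg (fun i hi => ?_) fun i _ _ => hX0 i
          rw [Finset.mem_map] at hi
          obtain ⟨n, hn, rfl⟩ := hi
          rw [Finset.mem_range] at hn ⊢
          simp only [addLeftEmbedding_apply]
          omega

end mixing

section potential

lemma abs_choiceCost_sub_le {ℓ : Bool → ℝ} {Γ : ℝ} (hΓ : 0 ≤ Γ) (bs : List Bool) :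
    |choiceCost ℓ Γ bs true - choiceCost ℓ Γ bs false| ≤ Γ := by
  cases bs with
  | nil => simpa [choiceCost] using hΓ
  | cons b bs =>
    simp only [choiceCost, Bool.not_true, Bool.not_false]
    rw [abs_le]
    constructor
    · rw [le_sub_iff_add_le, le_min_iff]
      constructor
      · linarith [min_le_right (choiceCost ℓ Γ bs false + if false = b then ℓ b else 0)
          (choiceCost ℓ Γ bs true + (if true = b then ℓ b else 0) + Γ)]
      · linarith [min_le_left (choiceCost ℓ Γ bs false + if false = b then ℓ b else 0)
          (choiceCost ℓ Γ bs true + (if true = b then ℓ b else 0) + Γ)]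
    · rw [sub_le_iff_le_add, ← sub_le_iff_le_add', le_min_iff]
      constructor
      · linarith [min_le_right (choiceCost ℓ Γ bs true + if true = b then ℓ b else 0)
          (choiceCost ℓ Γ bs false + (if false = b then ℓ b else 0) + Γ)]
      · linarith [min_le_left (choiceCost ℓ Γ bs true + if true = b then ℓ b else 0)
          (choiceCost ℓ Γ bs false + (if false = b then ℓ b else 0) + Γ)]

lemma expect_choiceCost_le {ℓ : Bool → ℝ} {Γ θ ρ : ℝ} (p : unitInterval) (hΓ : 0 ≤ Γ)
    (hℓ : ∀ b, 0 ≤ ℓ b) (hθ : 0 < θ)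
    (H : ∀ x, -Γ ≤ x → x ≤ Γ → p * ℓ true - ρ ≤
      p * ((Real.exp (θ * (x + ℓ true - Γ - ℓ true)) - Real.exp (θ * (x - Γ - ℓ true))) / θ) -
      (1 - p) * ((Real.exp (θ * (x - Γ - ℓ true)) -
        Real.exp (θ * (x - ℓ false - Γ - ℓ true))) / θ)) (n : ℕ) :
    ((ReqTree.coins p n).expect fun bs => choiceCost ℓ Γ bs true) ≤ n * ρ + 1 / θ := by
  set ψ : ℝ → ℝ := fun x => Real.exp (θ * (x - Γ - ℓ true)) / θ with hψ
  have hψ0 : ∀ x, 0 ≤ ψ x := fun x => by positivity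
  have hψmono : ∀ x y, x ≤ y → ψ x ≤ ψ y := fun x y hxy => by
    simp only [hψ]
    gcongr
  have hψlip : ∀ x y, x ≤ y → y ≤ Γ + ℓ true → ψ y - ψ x ≤ y - x := fun x y hxy hy => by
    simp only [hψ]
    rw [← sub_div, div_le_iff₀ hθ]
    have h1 := Real.add_one_le_exp (θ * (x - Γ - ℓ true) - θ * (y - Γ - ℓ true))
    have h2 : Real.exp (θ * (y - Γ - ℓ true)) ≤ 1 := Real.exp_le_one_iff.2 (by nlinarith)
    have h3 := Real.exp_pos (θ * (y - Γ - ℓ true))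
    have h4 : Real.exp (θ * (x - Γ - ℓ true)) = Real.exp (θ * (y - Γ - ℓ true)) *
        Real.exp (θ * (x - Γ - ℓ true) - θ * (y - Γ - ℓ true)) := by
      rw [← Real.exp_add]; congr 1; ring
    have h5 : 0 ≤ θ * (y - x) := by nlinarith
    rw [h4]
    nlinarith
  have H' : ∀ x, -Γ ≤ x → x ≤ Γ → p * ℓ true - ρ ≤
      p * (ψ (x + ℓ true) - ψ x) - (1 - p) * (ψ x - ψ (x - ℓ false)) := by
    intro x h1 h2
    have := H x h1 h2
    simp only [hψ, ← sub_div]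
    exact this
  have main : ∀ n, ((ReqTree.coins p n).expect fun bs => choiceCost ℓ Γ bs true -
      ψ (choiceCost ℓ Γ bs true - choiceCost ℓ Γ bs false)) ≤ n * ρ := by
    intro n
    induction n with
    | zero =>
      simp only [ReqTree.coins, FinDist.expect_pure, choiceCost]
      have := hψ0 (0 - 0)
      push_cast
      linarith
    | succ n ih =>
      simp only [ReqTree.coins, FinDist.expect_bind, FinDist.expect_map, FinDist.expect_bern,
        ← FinDist.expect_const_mul, ← FinDist.expect_add]
      push_cast
      rw [add_mul, one_mul]
      refine le_trans ?_ (add_le_add_left ih ρ)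
      rw [← FinDist.expect_const (ReqTree.coins p n) ρ, ← FinDist.expect_add]
      refine FinDist.expect_mono _ fun bs => ?_
      have hx := abs_le.1 (abs_choiceCost_sub_le (ℓ := ℓ) hΓ bs)
      simp only [choiceCost, Bool.not_true, Bool.not_false, if_true, reduceCtorEq, if_false,
        add_zero]
      generalize choiceCost ℓ Γ bs true = v at *
      generalize choiceCost ℓ Γ bs false = w at *
      have h0 := hℓ true
      have h0' := hℓ false
      rw [min_eq_left (show w ≤ v + ℓ true + Γ by linarith),
        min_eq_left (show v ≤ w + ℓ false + Γ by linarith)]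
      have e1 : min (v + ℓ true) (w + Γ) - ψ (min (v + ℓ true) (w + Γ) - w) ≤
          v + ℓ true - ψ (v - w + ℓ true) := by
        have := hψlip (min (v + ℓ true) (w + Γ) - w) (v - w + ℓ true)
          (by linarith [min_le_left (v + ℓ true) (w + Γ)]) (by linarith)
        linarith
      have e2 : v - ψ (v - min (w + ℓ false) (v + Γ)) ≤ v - ψ (v - w - ℓ false) := by
        have := hψmono (v - w - ℓ false) (v - min (w + ℓ false) (v + Γ))
          (by linarith [min_le_left (w + ℓ false) (v + Γ)])
        linarith
      have e3 := mul_le_mul_of_nonneg_left e1 p.2.1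
      have e4 := mul_le_mul_of_nonneg_left e2 (sub_nonneg.2 p.2.2)
      have e5 := H' (v - w) hx.1 hx.2
      nlinarith
  have hlast : ((ReqTree.coins p n).expect fun bs => choiceCost ℓ Γ bs true) ≤
      (ReqTree.coins p n).expect fun bs => choiceCost ℓ Γ bs true -
      ψ (choiceCost ℓ Γ bs true - choiceCost ℓ Γ bs false) + 1 / θ := by
    refine FinDist.expect_mono _ fun bs => ?_
    have hx := abs_le.1 (abs_choiceCost_sub_le (ℓ := ℓ) hΓ bs)
    have : ψ (choiceCost ℓ Γ bs true - choiceCost ℓ Γ bs false) ≤ 1 / θ := by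
      simp only [hψ]
      gcongr
      refine Real.exp_le_one_iff.2 ?_
      have := hℓ true
      nlinarith
    linarith
  rw [FinDist.expect_add, FinDist.expect_const] at hlast
  linarith [main n]

lemma one_sub_exp_neg_le {z : ℝ} (hz : 0 ≤ z) : 1 - Real.exp (-z) ≤ z / (1 + z / 4) := by
  rw [le_div_iff₀ (by positivity)]
  by_cases h : z ≤ 2
  · have h1 : (1 - z / 2) ^ 2 ≤ Real.exp (-z) := by
      have h2 : 1 - z / 2 ≤ Real.exp (-(z / 2)) := by
        have := Real.add_one_le_exp (-(z / 2)); linarith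
      calc (1 - z / 2) ^ 2 ≤ Real.exp (-(z / 2)) ^ 2 := by gcongr; linarith
        _ = Real.exp (-z) := by rw [← Real.exp_nat_mul]; congr 1; push_cast; ring
    nlinarith [mul_nonneg hz hz, mul_nonneg hz (sub_nonneg.2 h),
      mul_nonneg (mul_nonneg hz hz) (sub_nonneg.2 h)]
  · push Not at h
    have := Real.exp_pos (-z)
    nlinarith

lemma exists_expect_choiceCost_le {Δ g G₁ G₂ L L₁ L₂ : ℝ} (p : unitInterval) (hΔ : 0 < Δ)
    (hL₂ : 1 ≤ L₂) (hL : L₂ ≤ L₁) (hG₁ : 0 < G₁) (hG₁' : G₁ ≤ Δ / 4)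
    (hG₂ : Δ / 8 ≤ G₂) (h₁ : p * G₁ = g) (h₂ : (1 - p) * G₂ = g) (hg : 0 < g)
    (hLL : L₁ ≤ L) (hLγ : L ≤ L₁ + Real.exp (-2100 * (L₁ - L₂ + 1)) / 4) (J : ℕ) :
    ∃ P : ℕ, ((ReqTree.coins p (P + J)).expect fun bs =>
      choiceCost (pairF (G₁ / L₁) (G₂ / L₂)) (32 * Δ) bs true) ≤ (P + 1) * (g / L) := by
  set γ := Real.exp (-2100 * (L₁ - L₂ + 1)) with hγ
  have hγ0 : 0 < γ := Real.exp_pos _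
  have hL₁ : 1 ≤ L₁ := hL₂.trans hL
  set θ := 32 * (L₁ - L₂ + 1) / Δ with hθ
  have hs : 0 < L₁ - L₂ + 1 := by linarith
  have hθ0 : 0 < θ := by positivity
  set ρ := g / L₁ - g * γ / (L₁ * (L₁ + 1)) with hρ
  have hℓ₁ : G₁ / L₁ ≤ Δ / 4 := (div_le_self hG₁.le hL₁).trans hG₁'
  have hG₂0 : 0 < G₂ := by linarith
  have hbound := expect_choiceCost_le (ℓ := pairF (G₁ / L₁) (G₂ / L₂)) (Γ := 32 * Δ) (θ := θ)
    (ρ := ρ) p (by positivity) (by rintro (_ | _) <;> simp only [pairF] <;> positivity) hθ0 (by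
      intro x hx1 hx2
      simp only [pairF]
      set A := Real.exp (θ * (x - 32 * Δ - G₁ / L₁)) with hA
      have hAγ : γ ≤ A := by
        rw [hγ, hA, Real.exp_le_exp]
        have : -(64 * Δ + Δ / 4) ≤ x - 32 * Δ - G₁ / L₁ := by linarith
        have h3 := mul_le_mul_of_nonneg_left this hθ0.le
        have h4 : θ * -(64 * Δ + Δ / 4) = -2056 * (L₁ - L₂ + 1) := by
          rw [hθ]; field_simp; ring
        linarith
      have hA0 : 0 < A := Real.exp_pos _
      have e1 : Real.exp (θ * (x + G₁ / L₁ - 32 * Δ - G₁ / L₁)) =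
          A * Real.exp (θ * (G₁ / L₁)) := by
        rw [hA, ← Real.exp_add]; congr 1; ring
      have e2 : Real.exp (θ * (x - G₂ / L₂ - 32 * Δ - G₁ / L₁)) =
          A * Real.exp (-(θ * (G₂ / L₂))) := by
        rw [hA, ← Real.exp_add]; congr 1; ring
      rw [e1, e2]
      have f1 : A * (G₁ / L₁) ≤ (A * Real.exp (θ * (G₁ / L₁)) - A) / θ := by
        rw [le_div_iff₀ hθ0]
        have := Real.add_one_le_exp (θ * (G₁ / L₁))
        nlinarith
      have f2 : (A - A * Real.exp (-(θ * (G₂ / L₂)))) / θ ≤ A * (G₂ / (L₁ + 1)) := by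
        have hz : 0 ≤ θ * (G₂ / L₂) := by positivity
        have h3 := one_sub_exp_neg_le hz
        have h4 : θ * (G₂ / L₂) / (1 + θ * (G₂ / L₂) / 4) ≤ θ * (G₂ / (L₁ + 1)) := by
          rw [div_le_iff₀ (by positivity)]
          have h5 : L₁ + 1 ≤ L₂ * (1 + θ * (G₂ / L₂) / 4) := by
            have h6 : L₁ - L₂ + 1 ≤ θ * G₂ / 4 := by
              calc L₁ - L₂ + 1 = θ * (Δ / 8) / 4 := by rw [hθ]; field_simp; norm_num
                _ ≤ _ := by gcongr
            have h7 : L₂ * (1 + θ * (G₂ / L₂) / 4) = L₂ + θ * G₂ / 4 := by field_simp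
            linarith
          calc θ * (G₂ / L₂) = θ * G₂ / (L₂ * (L₁ + 1)) * (L₁ + 1) := by field_simp
            _ ≤ θ * G₂ / (L₂ * (L₁ + 1)) * (L₂ * (1 + θ * (G₂ / L₂) / 4)) := by gcongr
            _ = _ := by field_simp
        rw [div_le_iff₀ hθ0]
        nlinarith
      have g1 := mul_le_mul_of_nonneg_left f1 p.2.1
      have g2 := mul_le_mul_of_nonneg_left f2 (sub_nonneg.2 p.2.2)
      have k1 : (p : ℝ) * (G₁ / L₁) = g / L₁ := by rw [← h₁]; ring
      have k2 : (p : ℝ) * (A * (G₁ / L₁)) = A * (g / L₁) := by rw [← h₁]; ring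
      have k3 : (1 - (p : ℝ)) * (A * (G₂ / (L₁ + 1))) = A * (g / (L₁ + 1)) := by rw [← h₂]; ring
      have k4 : g * γ / (L₁ * (L₁ + 1)) = γ * (g / L₁ - g / (L₁ + 1)) := by
        field_simp; ring
      have k5 : 0 ≤ g / L₁ - g / (L₁ + 1) := by
        rw [sub_nonneg]; gcongr; linarith
      rw [k1, hρ, k4]
      nlinarith)
  have hρL : ρ < g / L := by
    have hL0 : 0 < L := by linarith
    rw [hρ, lt_div_iff₀ hL0]
    have h3 : g / L₁ - g * γ / (L₁ * (L₁ + 1)) = g * ((L₁ + 1 - γ) / (L₁ * (L₁ + 1))) := by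
      field_simp
    rw [h3, mul_assoc]
    refine mul_lt_of_lt_one_right hg ?_
    rw [div_mul_eq_mul_div, div_lt_one (by positivity)]
    nlinarith [mul_nonneg hγ0.le (sub_nonneg.2 hLL), mul_nonneg hγ0.le (sub_nonneg.2 hL₁),
      mul_pos hγ0 hγ0]
  obtain ⟨P, hP⟩ := exists_nat_gt ((J * ρ + 1 / θ) / (g / L - ρ))
  refine ⟨P, (hbound (P + J)).trans ?_⟩
  rw [div_lt_iff₀ (by linarith)] at hP
  have : 0 < g / L := by have : 0 < L := by linarith
                         positivity
  push_cast
  nlinarith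

variable {M : Type u} [MetricSpace M] [Finite M] [Nonempty M]

lemma Good.union {c Δ L L₁ L₂ G₁ G₂ Q₁ Q₂ : ℝ} {Y₁ Y₂ : Finset M} (hc : 0 ≤ c) (hΔ : 0 < Δ)
    (h₁ : Good c Y₁ G₁ Q₁ (G₁ / L₁)) (h₂ : Good c Y₂ G₂ Q₂ (G₂ / L₂))
    (hL₂ : 1 ≤ L₂) (hL : L₂ ≤ L₁) (hG₁ : 0 < G₁) (hG₁' : G₁ ≤ Δ / 4) (hG₂ : Δ / 8 ≤ G₂)
    (hQ₁ : Q₁ ≤ Δ) (hQ₂ : Q₂ ≤ Δ)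
    (hLL : L₁ ≤ L) (hLγ : L ≤ L₁ + Real.exp (-2100 * (L₁ - L₂ + 1)) / 4)
    (hsep : ∀ x ∈ Y₁, ∀ y ∈ Y₂, Δ ≤ dist x y)
    (hdiam : ∀ x ∈ Y₁ ∪ Y₂, ∀ y ∈ Y₁ ∪ Y₂, dist x y ≤ 32 * Δ) :
    ∃ g, 0 < g ∧ g ≤ G₁ ∧ Good c (Y₁ ∪ Y₂) g (max Q₁ Q₂) (g / L) := by
  have hG₂0 : 0 < G₂ := by linarith
  have hp : G₂ / (G₁ + G₂) ∈ unitInterval :=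
    ⟨by positivity, by rw [div_le_one (by positivity)]; linarith⟩
  set p : unitInterval := ⟨G₂ / (G₁ + G₂), hp⟩ with hpdef
  have e₁ : (p : ℝ) * G₁ = G₁ * G₂ / (G₁ + G₂) := by simp only [hpdef]; ring
  have e₂ : (1 - (p : ℝ)) * G₂ = G₁ * G₂ / (G₁ + G₂) := by simp only [hpdef]; field_simp; ring
  refine ⟨G₁ * G₂ / (G₁ + G₂), by positivity, ?_, ?_⟩
  · rw [div_le_iff₀ (by positivity)]; nlinarith
  refine Good.mix (Y := pairF Y₁ Y₂) (G := pairF G₁ G₂) (Q := pairF Q₁ Q₂)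
    (ℓ := pairF (G₁ / L₁) (G₂ / L₂)) (p := p) (Γ := 32 * Δ) hc ?_ ?_ ?_ ?_ e₁ e₂
    (exists_expect_choiceCost_le p hΔ hL₂ hL hG₁ hG₁' hG₂ e₁ e₂ (by positivity) hLL hLγ)
  · rintro (_ | _)
    · exact h₂
    · exact h₁
  · rw [Finset.disjoint_left]
    intro x hx hx'
    have := hsep x hx x hx'
    rw [dist_self] at this
    linarith
  · rintro (_ | _) x hx y hy
    · exact hQ₂.trans (hsep x hx y hy)
    · exact hQ₁.trans (hsep x hx y hy)
  · intro b b' x hx y hy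
    refine hdiam x ?_ y ?_
    · cases b <;> simp_all [pairF]
    · cases b' <;> simp_all [pairF]

end potential

section hierarchy

variable {M : Type u} [MetricSpace M]

/-- Hierarchically separated sets: at level `j` they have diameter at most `32 * Δ₀ * 4 ^ j` and
split into sets of the previous level at mutual distance at least `Δ₀ * 4 ^ j`. -/
def Hier (Δ₀ : ℝ) : ℕ → Finset M → Prop
  | 0, Y => ∃ y, Y = {y}
  | j + 1, Y => ∃ 𝒞 : Finset (Finset M), 𝒞.Nonempty ∧ (∀ C ∈ 𝒞, Hier Δ₀ j C) ∧
      (∀ C ∈ 𝒞, ∀ C' ∈ 𝒞, C ≠ C' → ∀ x ∈ C, ∀ y ∈ C', Δ₀ * 4 ^ (j + 1) ≤ dist x y) ∧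
      (∀ x ∈ Y, ∀ y ∈ Y, dist x y ≤ 32 * (Δ₀ * 4 ^ (j + 1))) ∧ 𝒞.biUnion id = Y

lemma Hier.nonempty {Δ₀ : ℝ} {j : ℕ} {Y : Finset M} (h : Hier Δ₀ j Y) : Y.Nonempty := by
  induction j generalizing Y with
  | zero => obtain ⟨y, rfl⟩ := h; simp
  | succ j ih =>
    obtain ⟨𝒞, ⟨C, hC⟩, h1, -, -, rfl⟩ := h
    obtain ⟨x, hx⟩ := ih (h1 C hC)
    exact ⟨x, Finset.mem_biUnion.2 ⟨C, hC, hx⟩⟩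

lemma mul_log_add_le {a m n : ℝ} (ha : 0 ≤ a) (ha₁ : a ≤ Real.exp (-2100) / 8400) (hn : 1 ≤ n)
    (hnm : n ≤ m) : 1 + a * Real.log (m + n) ≤ 1 + a * Real.log m +
      Real.exp (-2100 * (1 + a * Real.log m - (1 + a * Real.log n) + 1)) / 4 := by
  have hn0 : 0 < n := by linarith
  have hm0 : 0 < m := by linarith
  have h1 : Real.log (m + n) - Real.log m ≤ n / m := by
    rw [← Real.log_div (by positivity) (by positivity)]
    have := Real.log_le_sub_one_of_pos (show 0 < (m + n) / m by positivity)
    have h2 : (m + n) / m - 1 = n / m := by field_simp; ring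
    linarith
  have h3 : Real.exp (-2100) * (n / m) ≤
      Real.exp (-2100 * (1 + a * Real.log m - (1 + a * Real.log n) + 1)) := by
    have hlog : Real.log n ≤ Real.log m := Real.log_le_log hn0 hnm
    rw [show n / m = Real.exp (Real.log n - Real.log m) by
      rw [Real.exp_sub, Real.exp_log hn0, Real.exp_log hm0], ← Real.exp_add, Real.exp_le_exp]
    have h4 : Real.exp (-2100) ≤ 1 := Real.exp_le_one_iff.2 (by norm_num)
    nlinarith
  have h5 : 0 ≤ n / m := by positivity
  have h6 : a * (Real.log (m + n) - Real.log m) ≤ a * (n / m) :=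
    mul_le_mul_of_nonneg_left h1 ha
  have h7 : a * (n / m) ≤ Real.exp (-2100) / 8400 * (n / m) :=
    mul_le_mul_of_nonneg_right ha₁ h5
  have h8 : 0 ≤ Real.exp (-2100) * (n / m) := by positivity
  linarith

variable [Finite M] [Nonempty M]

lemma Good.biUnion {a c Δ : ℝ} (ha : 0 ≤ a) (ha₁ : a ≤ Real.exp (-2100) / 8400) (hc : 0 ≤ c)
    (hΔ : 0 < Δ) (𝒞 : Finset (Finset M)) (hne : 𝒞.Nonempty) (hC : ∀ C ∈ 𝒞, C.Nonempty)
    (hgood : ∀ C ∈ 𝒞, ∃ G, Δ / 8 ≤ G ∧ G ≤ Δ / 4 ∧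
      Good c C G Δ (G / (1 + a * Real.log C.card)))
    (hsep : ∀ C ∈ 𝒞, ∀ C' ∈ 𝒞, C ≠ C' → ∀ x ∈ C, ∀ y ∈ C', Δ ≤ dist x y)
    (hdiam : ∀ x ∈ 𝒞.biUnion id, ∀ y ∈ 𝒞.biUnion id, dist x y ≤ 32 * Δ) :
    ∃ g, 0 < g ∧ g ≤ Δ / 4 ∧
      Good c (𝒞.biUnion id) g Δ (g / (1 + a * Real.log (𝒞.biUnion id).card)) := by
  revert hne hC hgood hsep hdiam
  refine Finset.induction_on_min_value Finset.card 𝒞 ?_ ?_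
  · intro hne
    simp at hne
  · intro C s hCs hmin ih hne hC hgood hsep hdiam
    obtain ⟨G, hG1, hG2, hG⟩ := hgood C (Finset.mem_insert_self _ _)
    rcases s.eq_empty_or_nonempty with rfl | hs
    · refine ⟨G, by linarith, hG2, ?_⟩
      simpa using hG
    · have hsub : ∀ C' ∈ s, C' ∈ insert C s := fun C' h => Finset.mem_insert_of_mem h
      rw [Finset.biUnion_insert] at hdiam ⊢
      simp only [id] at hdiam ⊢
      rw [Finset.union_comm] at hdiam ⊢
      obtain ⟨g, hg0, hg1, hg⟩ := ih hs (fun C' h => hC C' (hsub C' h))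
        (fun C' h => hgood C' (hsub C' h))
        (fun C' h C'' h' => hsep C' (hsub C' h) C'' (hsub C'' h'))
        (fun x hx y hy => hdiam x (Finset.mem_union_left _ hx) y (Finset.mem_union_left _ hy))
      have hsep' : ∀ x ∈ s.biUnion id, ∀ y ∈ C, Δ ≤ dist x y := by
        intro x hx y hy
        obtain ⟨C', hC', hx'⟩ := Finset.mem_biUnion.1 hx
        exact hsep C' (hsub C' hC') C (Finset.mem_insert_self _ _)
          (fun h => hCs (h ▸ hC')) x hx' y hy
      have hdisj : Disjoint (s.biUnion id) C := by
        rw [Finset.disjoint_left]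
        intro x hx hx'
        have := hsep' x hx x hx'
        rw [dist_self] at this
        linarith
      have hcard : C.card ≤ (s.biUnion id).card := by
        obtain ⟨C', hC'⟩ := hs
        exact (hmin C' hC').trans (Finset.card_le_card (Finset.subset_biUnion_of_mem id hC'))
      have hC1 : (1 : ℝ) ≤ C.card := by
        exact_mod_cast Finset.card_pos.2 (hC C (Finset.mem_insert_self _ _))
      have hcard' : (C.card : ℝ) ≤ (s.biUnion id).card := by exact_mod_cast hcard
      rw [Finset.card_union_of_disjoint hdisj]
      push_cast
      have hlogC := Real.log_nonneg hC1
      have hlog := Real.log_le_log (by linarith) hcard'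
      have hlog' := Real.log_le_log (show 0 < ((s.biUnion id).card : ℝ) by linarith)
        (show ((s.biUnion id).card : ℝ) ≤ (s.biUnion id).card + C.card by linarith)
      have h1 := mul_le_mul_of_nonneg_left hlog ha
      have h2 := mul_le_mul_of_nonneg_left hlog' ha
      obtain ⟨g', h3, h4, h5⟩ := Good.union hc hΔ hg hG
        (L := 1 + a * Real.log ((s.biUnion id).card + C.card))
        (by nlinarith) (by linarith) hg0 hg1 hG1 le_rfl le_rfl (by linarith)
        (mul_log_add_le ha ha₁ hC1 hcard') hsep' hdiam
      exact ⟨g', h3, h4.trans hg1, by simpa using h5⟩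

lemma Hier.good {a Δ₀ : ℝ} (ha : 0 ≤ a) (ha₁ : a ≤ Real.exp (-2100) / 8400) (hΔ : 0 < Δ₀)
    {j : ℕ} {Y : Finset M} (h : Hier Δ₀ j Y) : ∃ g Q, 0 < g ∧ g ≤ Δ₀ * 4 ^ j / 4 ∧ g ≤ Q ∧
      Q ≤ Δ₀ * 4 ^ j ∧ Good (Δ₀ / 4) Y g Q (g / (1 + a * Real.log Y.card)) := by
  induction j generalizing Y with
  | zero =>
    obtain ⟨y, rfl⟩ := h
    refine ⟨Δ₀ / 4, Δ₀ / 4, by positivity, by simp, le_rfl, by simp; linarith, ?_⟩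
    simpa using good_singleton (show 0 ≤ Δ₀ / 4 by positivity) y
  | succ j ih =>
    obtain ⟨𝒞, hne, hH, hsep, hdiam, rfl⟩ := h
    have hj : 0 < Δ₀ * 4 ^ j := by positivity
    have hj' : Δ₀ * 4 ^ (j + 1) = 4 * (Δ₀ * 4 ^ j) := by ring
    obtain ⟨g, h1, h2, h3⟩ := Good.biUnion ha ha₁ (show 0 ≤ Δ₀ / 4 by positivity)
      (show 0 < Δ₀ * 4 ^ (j + 1) by positivity) 𝒞 hne (fun C hC => (hH C hC).nonempty)
      (fun C hC => by
        obtain ⟨g, Q, h1, h2, h3, h4, h5⟩ := ih (hH C hC)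
        have hfl := Nat.floor_le (show 0 ≤ Δ₀ * 4 ^ j / g by positivity)
        have hlt := Nat.lt_floor_add_one (Δ₀ * 4 ^ j / g)
        rw [le_div_iff₀ h1] at hfl
        rw [div_lt_iff₀ h1] at hlt
        refine ⟨⌊Δ₀ * 4 ^ j / g⌋₊ * g, by linarith, by linarith, ?_⟩
        rw [mul_div_assoc (⌊Δ₀ * 4 ^ j / g⌋₊ : ℝ)]
        exact h5.iter h1.le h3 ⌊Δ₀ * 4 ^ j / g⌋₊ (Q' := Δ₀ * 4 ^ (j + 1)) (by linarith)) hsep hdiam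
    exact ⟨g, Δ₀ * 4 ^ (j + 1), h1, h2, by linarith, le_rfl, h3⟩

end hierarchy

section ramsey

variable {M : Type u} [MetricSpace M]

/-- The points of `X` within distance `r` of `x`. -/
noncomputable def ballIn (X : Finset M) (x : M) (r : ℝ) : Finset M := X.filter fun y => dist x y ≤ r

/-- The sum over the points of `X` of `1 / √b`, where `b` is the number of points in the ball of
radius `r`. -/
noncomputable def density (r : ℝ) (X : Finset M) : ℝ := ∑ x ∈ X, 1 / √((ballIn X x r).card)

lemma self_mem_ballIn {X : Finset M} {x : M} (hx : x ∈ X) {r : ℝ} (hr : 0 ≤ r) :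
    x ∈ ballIn X x r := by
  simp [ballIn, hx, hr]

lemma card_ballIn_pos {X : Finset M} {x : M} (hx : x ∈ X) {r : ℝ} (hr : 0 ≤ r) :
    (0 : ℝ) < (ballIn X x r).card := by
  exact_mod_cast Finset.card_pos.2 ⟨x, self_mem_ballIn hx hr⟩

lemma card_ballIn_mono {X X' : Finset M} (h : X ⊆ X') (x : M) (r : ℝ) :
    ((ballIn X x r).card : ℝ) ≤ (ballIn X' x r).card := by
  exact_mod_cast Finset.card_le_card (Finset.filter_subset_filter _ h)

lemma density_pos {X : Finset M} (hX : X.Nonempty) {r : ℝ} (hr : 0 ≤ r) : 0 < density r X :=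
  Finset.sum_pos (fun x hx => by have := card_ballIn_pos hx hr; positivity) hX

/-- Every finite set contains well separated pieces of small diameter that carry its density. -/
lemma exists_separated_pieces {R : ℝ} (hR : 0 < R) {p : Finset M → Prop}
    (hp : ∀ X : Finset M, X.Nonempty → (∀ x ∈ X, ∀ y ∈ X, dist x y ≤ R) →
      ∃ Y ⊆ X, Y.Nonempty ∧ p Y ∧ density (R / 4) X ≤ Y.card) (X : Finset M) :
    ∃ 𝒞 : Finset (Finset M), (∀ C ∈ 𝒞, C ⊆ X ∧ C.Nonempty ∧ p C) ∧
      (∀ C ∈ 𝒞, ∀ C' ∈ 𝒞, C ≠ C' → ∀ x ∈ C, ∀ y ∈ C', R / 8 ≤ dist x y) ∧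
      density R X ≤ ∑ C ∈ 𝒞, (C.card : ℝ) := by
  induction X using Finset.strongInduction with
  | H X ih =>
  rcases X.eq_empty_or_nonempty with rfl | hX
  · exact ⟨∅, by simp, by simp, by simp [density]⟩
  obtain ⟨x₀, hx₀, hmax⟩ := X.exists_max_image (fun x => (ballIn X x (R / 4)).card) hX
  obtain ⟨s, t, hs, hst, ht, hcard⟩ : ∃ s t, R / 4 ≤ s ∧ s + R / 8 = t ∧ t ≤ R / 2 ∧
      ((ballIn X x₀ t).card : ℝ) * √((ballIn X x₀ (R / 4)).card) ≤
        (ballIn X x₀ s).card * √((ballIn X x₀ (R / 2)).card) := by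
    by_contra! hcon
    have h1 := hcon (R / 4) (3 * R / 8) le_rfl (by ring) (by linarith)
    have h2 := hcon (3 * R / 8) (R / 2) (by linarith) (by ring) le_rfl
    have ha := card_ballIn_pos hx₀ (show 0 ≤ R / 4 by positivity)
    have hb := card_ballIn_pos hx₀ (show 0 ≤ R / 2 by positivity)
    generalize ((ballIn X x₀ (R / 4)).card : ℝ) = a at *
    generalize ((ballIn X x₀ (R / 2)).card : ℝ) = b at *
    generalize ((ballIn X x₀ (3 * R / 8)).card : ℝ) = m at *
    have ha' := Real.sqrt_pos.2 ha
    have hb' := Real.sqrt_pos.2 hb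
    have ea := Real.mul_self_sqrt ha.le
    have eb := Real.mul_self_sqrt hb.le
    generalize √a = u at *
    generalize √b = v at *
    subst ea eb
    have h3 : u * v < m := by nlinarith
    nlinarith
  set C₀ := ballIn X x₀ s with hC₀
  have hx₀C : x₀ ∈ C₀ := self_mem_ballIn hx₀ (by linarith)
  obtain ⟨C, hCC, hCne, hpC, hCcard⟩ := hp C₀ ⟨x₀, hx₀C⟩ fun x hx y hy => by
    have h1 := (Finset.mem_filter.1 hx).2
    have h2 := (Finset.mem_filter.1 hy).2
    linarith [dist_triangle_left x y x₀]
  set X' := X \ ballIn X x₀ t with hX'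
  have hX'X : X' ⊂ X := by
    refine Finset.ssubset_iff_subset_ne.2 ⟨Finset.sdiff_subset, fun h => ?_⟩
    have : x₀ ∈ X' := h ▸ hx₀
    exact (Finset.mem_sdiff.1 this).2 (self_mem_ballIn hx₀ (by linarith))
  obtain ⟨𝒞, h1, h2, h3⟩ := ih X' hX'X
  have hsep : ∀ x ∈ C, ∀ y ∈ X', R / 8 ≤ dist x y := by
    intro x hx y hy
    have hx' := (Finset.mem_filter.1 (hCC hx)).2
    have hy' := Finset.mem_sdiff.1 hy
    have : t < dist x₀ y := by
      by_contra! hcon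
      exact hy'.2 (Finset.mem_filter.2 ⟨hy'.1, hcon⟩)
    linarith [dist_triangle x₀ x y]
  have hC𝒞 : C ∉ 𝒞 := by
    intro hmem
    obtain ⟨x, hx⟩ := hCne
    have := hsep x hx x ((h1 C hmem).1 hx)
    rw [dist_self] at this
    linarith
  refine ⟨insert C 𝒞, ?_, ?_, ?_⟩
  · intro C' hC'
    rcases Finset.mem_insert.1 hC' with rfl | hC'
    · exact ⟨hCC.trans (Finset.filter_subset _ _), hCne, hpC⟩
    · exact ⟨(h1 C' hC').1.trans Finset.sdiff_subset, (h1 C' hC').2⟩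
  · intro D hD D' hD' hne x hx y hy
    rcases Finset.mem_insert.1 hD with rfl | hmem
    · rcases Finset.mem_insert.1 hD' with rfl | hD'
      · exact absurd rfl hne
      · exact hsep x hx y ((h1 D' hD').1 hy)
    · rcases Finset.mem_insert.1 hD' with rfl | hD'
      · rw [dist_comm]
        exact hsep y hy x ((h1 _ hmem).1 hx)
      · exact h2 D hmem D' hD' hne x hx y hy
  · rw [Finset.sum_insert hC𝒞]
    have hsplit : density R X = ∑ x ∈ ballIn X x₀ t, 1 / √((ballIn X x R).card) +
        ∑ x ∈ X', 1 / √((ballIn X x R).card) := by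
      rw [add_comm]
      exact (Finset.sum_sdiff (Finset.filter_subset _ _)).symm
    have ha := card_ballIn_pos hx₀ (show 0 ≤ R / 4 by positivity)
    have hb := card_ballIn_pos hx₀ (show 0 ≤ R / 2 by positivity)
    have e1 : ∑ x ∈ X', 1 / √((ballIn X x R).card) ≤ density R X' := by
      refine Finset.sum_le_sum fun x hx => ?_
      have := card_ballIn_pos hx hR.le
      have := card_ballIn_mono hX'X.subset x R
      gcongr
    have e2 : ∑ x ∈ ballIn X x₀ t, 1 / √((ballIn X x R).card) ≤
        (ballIn X x₀ t).card * (1 / √((ballIn X x₀ (R / 2)).card)) := by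
      rw [← nsmul_eq_mul, ← Finset.sum_const]
      refine Finset.sum_le_sum fun x hx => ?_
      have : ((ballIn X x₀ (R / 2)).card : ℝ) ≤ (ballIn X x R).card := by
        refine Nat.cast_le.2 (Finset.card_le_card fun y hy => ?_)
        have hx' := Finset.mem_filter.1 hx
        have hy' := Finset.mem_filter.1 hy
        refine Finset.mem_filter.2 ⟨hy'.1, ?_⟩
        linarith [dist_triangle_left x y x₀]
      gcongr
    have e3 : (C₀.card : ℝ) * (1 / √((ballIn X x₀ (R / 4)).card)) ≤ density (R / 4) C₀ := by
      rw [← nsmul_eq_mul, ← Finset.sum_const]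
      refine Finset.sum_le_sum fun x hx => ?_
      have h4 := card_ballIn_pos hx (show 0 ≤ R / 4 by positivity)
      have h5 : ((ballIn C₀ x (R / 4)).card : ℝ) ≤ (ballIn X x (R / 4)).card :=
        card_ballIn_mono (Finset.filter_subset _ _) x (R / 4)
      have h6 : ((ballIn X x (R / 4)).card : ℝ) ≤ (ballIn X x₀ (R / 4)).card :=
        Nat.cast_le.2 (hmax x (Finset.mem_filter.1 hx).1)
      have := h5.trans h6
      gcongr
    have e4 : (ballIn X x₀ t).card * (1 / √((ballIn X x₀ (R / 2)).card)) ≤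
        (C₀.card : ℝ) * (1 / √((ballIn X x₀ (R / 4)).card)) := by
      rw [mul_one_div, mul_one_div, div_le_div_iff₀ (Real.sqrt_pos.2 hb) (Real.sqrt_pos.2 ha)]
      exact hcard
    linarith

lemma exists_hier {Δ₀ : ℝ} (hΔ : 0 < Δ₀) (hmin : ∀ x y : M, x ≠ y → 32 * Δ₀ < dist x y) (j : ℕ)
    (X : Finset M) (hX : X.Nonempty) (hdiam : ∀ x ∈ X, ∀ y ∈ X, dist x y ≤ 32 * (Δ₀ * 4 ^ j)) :
    ∃ Y ⊆ X, Y.Nonempty ∧ Hier Δ₀ j Y ∧ density (8 * (Δ₀ * 4 ^ j)) X ≤ Y.card := by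
  induction j generalizing X with
  | zero =>
    obtain ⟨x, hx⟩ := hX
    have : X = {x} := by
      refine Finset.eq_singleton_iff_unique_mem.2 ⟨hx, fun y hy => ?_⟩
      by_contra hne
      have h1 := hmin y x hne
      have h2 := hdiam y hy x hx
      simp only [pow_zero, mul_one] at h2
      linarith
    subst this
    refine ⟨{x}, subset_rfl, by simp, ⟨x, rfl⟩, ?_⟩
    have hb : ballIn {x} x (8 * (Δ₀ * 4 ^ 0)) = {x} := by
      simp [ballIn, Finset.filter_singleton, hΔ.le]
    rw [density, Finset.sum_singleton, hb]
    simp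
  | succ j ih =>
    have hR : 0 < 8 * (Δ₀ * 4 ^ (j + 1)) := by positivity
    have e1 : 8 * (Δ₀ * 4 ^ (j + 1)) / 4 = 8 * (Δ₀ * 4 ^ j) := by ring
    have e2 : 8 * (Δ₀ * 4 ^ (j + 1)) = 32 * (Δ₀ * 4 ^ j) := by ring
    have e3 : 8 * (Δ₀ * 4 ^ (j + 1)) / 8 = Δ₀ * 4 ^ (j + 1) := by ring
    obtain ⟨𝒞, h1, h2, h3⟩ := exists_separated_pieces hR (p := Hier Δ₀ j)
      (fun X hX hd => by rw [e1]; exact ih X hX (by rwa [e2] at hd)) X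
    rw [e3] at h2
    have hsub : 𝒞.biUnion id ⊆ X := Finset.biUnion_subset.2 fun C hC => (h1 C hC).1
    have hne : 𝒞.Nonempty := by
      rw [Finset.nonempty_iff_ne_empty]
      rintro rfl
      have := density_pos hX hR.le
      rw [Finset.sum_empty] at h3
      linarith
    refine ⟨𝒞.biUnion id, hsub, ?_, ⟨𝒞, hne, fun C hC => (h1 C hC).2.2, h2,
      fun x hx y hy => hdiam x (hsub hx) y (hsub hy), rfl⟩, ?_⟩
    · obtain ⟨C, hC⟩ := hne
      exact (h1 C hC).2.1.mono (Finset.subset_biUnion_of_mem id hC)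
    · rw [Finset.card_biUnion]
      · push_cast
        exact h3
      · intro C hC C' hC' hne
        rw [Function.onFun, Finset.disjoint_left]
        intro x hx hx'
        have := h2 C hC C' hC' hne x hx x hx'
        rw [dist_self] at this
        have : 0 < Δ₀ * 4 ^ (j + 1) := by positivity
        linarith

lemma Hier.subtype {Δ₀ : ℝ} {Y : Finset M} {j : ℕ} {C : Finset M} (hCY : C ⊆ Y)
    (h : Hier Δ₀ j C) : Hier Δ₀ j (C.subtype (· ∈ Y)) := by
  induction j generalizing C with
  | zero =>
    obtain ⟨y, rfl⟩ := h
    exact ⟨⟨y, hCY (by simp)⟩, by ext z; simp [Subtype.ext_iff]⟩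
  | succ j ih =>
    obtain ⟨𝒞, h0, h1, h2, h3, rfl⟩ := h
    have hsub : ∀ C ∈ 𝒞, C ⊆ Y := fun C hC => (Finset.subset_biUnion_of_mem id hC).trans hCY
    refine ⟨𝒞.image fun C => C.subtype (· ∈ Y), h0.image _, fun C' hC' => ?_, ?_, ?_, ?_⟩
    · obtain ⟨C, hC, rfl⟩ := Finset.mem_image.1 hC'
      exact ih (hsub C hC) (h1 C hC)
    · intro C' hC' D' hD' hne x hx y hy
      obtain ⟨C, hC, rfl⟩ := Finset.mem_image.1 hC'
      obtain ⟨D, hD, rfl⟩ := Finset.mem_image.1 hD'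
      exact h2 C hC D hD (fun h => hne (by rw [h])) x (by simpa using hx) y (by simpa using hy)
    · intro x hx y hy
      exact h3 x (by simpa using hx) y (by simpa using hy)
    · ext z
      simp

lemma exists_good_subset [Finite M] {a Δ₀ : ℝ} (ha : 0 ≤ a) (ha₁ : a ≤ Real.exp (-2100) / 8400)
    (hΔ : 0 < Δ₀) (hmin : ∀ x y : M, x ≠ y → 32 * Δ₀ < dist x y) {X : Finset M}
    (hX : X.Nonempty) :
    ∃ Y ⊆ X, Y.Nonempty ∧ √(X.card) ≤ Y.card ∧ ∃ g Q, 0 < g ∧ g ≤ Q ∧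
      Good (Δ₀ / 4) (Finset.univ : Finset Y) g Q (g / (1 + a * Real.log Y.card)) := by
  obtain ⟨D, hD⟩ : ∃ D : ℝ, ∀ x y : M, dist x y ≤ D := by
    obtain ⟨D, hD⟩ := (Set.finite_range fun z : M × M => dist z.1 z.2).bddAbove
    exact ⟨D, fun x y => hD ⟨(x, y), rfl⟩⟩
  obtain ⟨j, hj⟩ := pow_unbounded_of_one_lt (D / (32 * Δ₀)) (show (1 : ℝ) < 4 by norm_num)
  rw [div_lt_iff₀ (by positivity)] at hj
  obtain ⟨Y, hYX, hne, hY, hcard⟩ := exists_hier hΔ hmin j X hX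
    fun x _ y _ => by linarith [hD x y]
  have := hne.to_subtype
  have huniv : Y.subtype (· ∈ Y) = Finset.univ := by ext z; simp
  have hY' := hY.subtype subset_rfl
  rw [huniv] at hY'
  obtain ⟨g, Q, h1, -, hgQ, -, h2⟩ := hY'.good ha ha₁ hΔ
  rw [Finset.card_univ, Fintype.card_coe] at h2
  refine ⟨Y, hYX, hne, le_trans ?_ hcard, g, Q, h1, hgQ, h2⟩
  have hpos : (0 : ℝ) < X.card := by exact_mod_cast hX.card_pos
  calc √(X.card) = ∑ _x ∈ X, 1 / √(X.card) := by
        rw [Finset.sum_const, nsmul_eq_mul, mul_one_div, Real.div_sqrt]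
    _ ≤ _ := by
        refine Finset.sum_le_sum fun x hx => ?_
        have h3 := card_ballIn_pos hx (show 0 ≤ 8 * (Δ₀ * 4 ^ j) by positivity)
        have h4 : ((ballIn X x (8 * (Δ₀ * 4 ^ j))).card : ℝ) ≤ X.card :=
          Nat.cast_le.2 (Finset.card_le_card (Finset.filter_subset _ _))
        gcongr

end ramsey

section configurations

variable {M : Type u} [MetricSpace M]

/-- The configuration `S` is obtained from `N` minus the point `x` (the hole) by displacing
servers by a total of at most `m`. -/
def Matched (N S : Finset M) (x : M) (m : ℝ) : Prop :=
  x ∈ N ∧ ∃ e : M → M, Set.InjOn e (N.erase x) ∧ S = (N.erase x).image e ∧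
    ∑ y ∈ N.erase x, dist y (e y) ≤ m

lemma matched_erase {N : Finset M} {x : M} (hx : x ∈ N) : Matched N (N.erase x) x 0 :=
  ⟨hx, id, Function.injective_id.injOn, by simp, by simp⟩

lemma Matched.nonneg {N S : Finset M} {x : M} {m : ℝ} (h : Matched N S x m) : 0 ≤ m := by
  obtain ⟨-, e, -, -, h⟩ := h
  exact (Finset.sum_nonneg fun _ _ => dist_nonneg).trans h

lemma Matched.card {N S : Finset M} {x : M} {m : ℝ} (h : Matched N S x m) :
    S.card + 1 = N.card := by
  obtain ⟨hx, e, he, rfl, -⟩ := h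
  rw [Finset.card_image_of_injOn he, Finset.card_erase_add_one hx]

lemma kStepCost_nonneg (S S' : Finset M) : 0 ≤ kStepCost dist S S' :=
  Finset.sum_nonneg fun _ _ => Finset.sum_nonneg fun _ _ => dist_nonneg

lemma step_cases {S S' : Finset M} (hc : S'.card = S.card) (h1 : (S' \ S).card ≤ 1) :
    S' = S ∨ ∃ u ∈ S, ∃ v ∉ S, S' = insert v (S.erase u) ∧ kStepCost dist S S' = dist u v := by
  have hc' : (S \ S').card = (S' \ S).card := by
    have e1 := Finset.card_sdiff_add_card_inter S S'
    have e2 := Finset.card_sdiff_add_card_inter S' S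
    rw [Finset.inter_comm] at e2
    omega
  rcases Nat.le_one_iff_eq_zero_or_eq_one.1 h1 with h | h
  · left
    exact Finset.eq_of_subset_of_card_le (Finset.sdiff_eq_empty_iff_subset.1
      (Finset.card_eq_zero.1 h)) hc.ge
  · right
    obtain ⟨v, hv⟩ := Finset.card_eq_one.1 h
    obtain ⟨u, hu⟩ := Finset.card_eq_one.1 (hc'.trans h)
    have hv' : ∀ z, (z ∈ S' ∧ z ∉ S) ↔ z = v := fun z => by
      rw [← Finset.mem_sdiff, hv, Finset.mem_singleton]
    have hu' : ∀ z, (z ∈ S ∧ z ∉ S') ↔ z = u := fun z => by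
      rw [← Finset.mem_sdiff, hu, Finset.mem_singleton]
    refine ⟨u, ((hu' u).2 rfl).1, v, ((hv' v).2 rfl).2, ?_, ?_⟩
    · ext z
      rw [Finset.mem_insert, Finset.mem_erase, ← hv', Ne, ← hu']
      tauto
    · simp [kStepCost, hu, hv]

lemma Matched.move {N S S' : Finset M} {x : M} {m : ℝ} (h : Matched N S x m)
    (hc : S'.card = S.card) (h1 : (S' \ S).card ≤ 1) :
    Matched N S' x (m + kStepCost dist S S') := by
  rcases step_cases hc h1 with rfl | ⟨u, hu, v, hv, rfl, hcost⟩
  · simpa [kStepCost] using h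
  obtain ⟨hx, e, he, rfl, hm⟩ := h
  obtain ⟨y, hy, rfl⟩ := Finset.mem_image.1 hu
  have hne : ∀ z ∈ (N.erase x).erase y, Function.update e y v z = e z := fun z hz =>
    Function.update_of_ne (Finset.ne_of_mem_erase hz) _ _
  refine ⟨hx, Function.update e y v, ?_, ?_, ?_⟩
  · intro z hz w hw hzw
    simp only [Function.update_apply] at hzw
    split_ifs at hzw with h1 h2 h2
    · rw [h1, h2]
    · exact absurd (Finset.mem_image.2 ⟨w, hw, hzw.symm⟩) hv
    · exact absurd (Finset.mem_image.2 ⟨z, hz, hzw⟩) hv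
    · exact he hz hw hzw
  · conv_rhs => rw [← Finset.insert_erase hy, Finset.image_insert, Function.update_self,
      Finset.image_congr (g := e) fun z hz => hne z hz]
    congr 1
    ext z
    simp only [Finset.mem_erase (s := Finset.image _ _), Finset.mem_image]
    constructor
    · rintro ⟨hz, w, hw, rfl⟩
      exact ⟨w, Finset.mem_erase.2 ⟨fun h => hz (by rw [h]), hw⟩, rfl⟩
    · rintro ⟨w, hw, rfl⟩
      have hw' := Finset.mem_erase.1 hw
      exact ⟨fun h => hw'.1 (he hw'.2 hy h), w, hw'.2, rfl⟩
  · rw [← Finset.add_sum_erase _ _ hy] at hm ⊢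
    rw [Function.update_self, Finset.sum_congr rfl fun z hz => by rw [hne z hz], hcost]
    linarith [dist_triangle y (e y) v]

/-- Moving the hole. -/
lemma Matched.move_hole {N S : Finset M} {x x' : M} {m : ℝ} (h : Matched N S x m) (hx' : x' ∈ N) :
    Matched N S x' (m + dist x x') := by
  obtain ⟨hx, e, he, rfl, hm⟩ := h
  by_cases hxx : x = x'
  · subst hxx
    exact ⟨hx, e, he, rfl, by simpa using hm⟩
  have hxe : x ∈ N.erase x' := Finset.mem_erase.2 ⟨hxx, hx⟩
  have hxe' : x' ∈ N.erase x := Finset.mem_erase.2 ⟨Ne.symm hxx, hx'⟩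
  have hne : ∀ z ∈ (N.erase x').erase x, Function.update e x (e x') z = e z := fun z hz =>
    Function.update_of_ne (Finset.ne_of_mem_erase hz) _ _
  refine ⟨hx', Function.update e x (e x'), ?_, ?_, ?_⟩
  · intro z hz w hw hzw
    have hz := Finset.mem_erase.1 hz
    have hw := Finset.mem_erase.1 hw
    simp only [Function.update_apply] at hzw
    split_ifs at hzw with h1 h2 h2
    · rw [h1, h2]
    · exact absurd (he hxe' (Finset.mem_erase.2 ⟨h2, hw.2⟩) hzw).symm hw.1
    · exact absurd (he (Finset.mem_erase.2 ⟨h1, hz.2⟩) hxe' hzw) hz.1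
    · exact he (Finset.mem_erase.2 ⟨h1, hz.2⟩) (Finset.mem_erase.2 ⟨h2, hw.2⟩) hzw
  · conv_rhs => rw [← Finset.insert_erase hxe, Finset.image_insert, Function.update_self,
      Finset.image_congr (g := e) fun z hz => hne z hz, Finset.erase_right_comm]
    rw [← Finset.image_insert, Finset.insert_erase hxe']
  · rw [← Finset.add_sum_erase _ _ hxe'] at hm
    rw [← Finset.add_sum_erase _ _ hxe, Function.update_self,
      Finset.sum_congr rfl fun z hz => by rw [hne z hz], Finset.erase_right_comm]
    linarith [dist_triangle x x' (e x')]

/-- The effect of a request on the hole. -/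
lemma Matched.request {N S S' : Finset M} {x r : M} {m : ℝ} (h : Matched N S x m)
    (hc : S'.card = S.card) (hr : r ∈ S') (h1 : (S' \ S).card ≤ 1) :
    ∃ x' ≠ r, ∃ m', Matched N S' x' m' ∧ dist x x' + m' ≤ kStepCost dist S S' + m ∧
      (x ≠ r → x' = x) := by
  have h2 := h.move hc h1
  by_cases hxr : x = r
  swap
  · exact ⟨x, hxr, _, h2, by rw [dist_self]; linarith, fun _ => rfl⟩
  subst hxr
  obtain ⟨hx, e, he, rfl, hm⟩ := h2
  obtain ⟨y, hy, hyx⟩ := Finset.mem_image.1 hr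
  have hy' := Finset.mem_erase.1 hy
  have hxe : x ∈ N.erase y := Finset.mem_erase.2 ⟨Ne.symm hy'.1, hx⟩
  have hne : ∀ z ∈ (N.erase y).erase x, Function.update e x x z = e z := fun z hz =>
    Function.update_of_ne (Finset.ne_of_mem_erase hz) _ _
  refine ⟨y, hy'.1, ∑ z ∈ (N.erase x).erase y, dist z (e z),
    ⟨hy'.2, Function.update e x x, ?_, ?_, ?_⟩, ?_, fun h => absurd rfl h⟩
  · intro z hz w hw hzw
    have hz := Finset.mem_erase.1 hz
    have hw := Finset.mem_erase.1 hw
    simp only [Function.update_apply] at hzw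
    split_ifs at hzw with h1 h2 h2
    · rw [h1, h2]
    · exact absurd (he hy (Finset.mem_erase.2 ⟨h2, hw.2⟩) (hyx.trans hzw)).symm hw.1
    · exact absurd (he (Finset.mem_erase.2 ⟨h1, hz.2⟩) hy (hzw.trans hyx.symm)) hz.1
    · exact he (Finset.mem_erase.2 ⟨h1, hz.2⟩) (Finset.mem_erase.2 ⟨h2, hw.2⟩) hzw
  · conv_rhs => rw [← Finset.insert_erase hxe, Finset.image_insert, Function.update_self,
      Finset.image_congr (g := e) fun z hz => hne z hz, Finset.erase_right_comm]
    conv_rhs => rw [← hyx, ← Finset.image_insert]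
    rw [hyx, Finset.insert_erase hy]
  · rw [← Finset.add_sum_erase _ _ hxe, Function.update_self, dist_self, zero_add,
      Finset.sum_congr rfl fun z hz => by rw [hne z hz], Finset.erase_right_comm]
  · rw [← Finset.add_sum_erase _ _ hy, hyx, dist_comm] at hm
    linarith

end configurations

section runs

variable {M : Type u} [MetricSpace M]

/-- `Run k S σ S' v`: from the configuration `S`, a player can serve `σ` one move per request,
ending in `S'`, at cost `v`. -/
inductive Run (k : ℕ) : Finset M → List M → Finset M → ℝ → Prop
  | nil (S : Finset M) : Run k S [] S 0
  | cons {S S' S'' : Finset M} {r : M} {σ : List M} {v : ℝ} (hc : S'.card = k) (hr : r ∈ S')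
      (h1 : (S' \ S).card ≤ 1) (h : Run k S' σ S'' v) :
      Run k S (r :: σ) S'' (kStepCost dist S S' + v)

lemma Run.of_append {k : ℕ} {σ τ : List M} {S S'' : Finset M} {v : ℝ}
    (h : Run k S (σ ++ τ) S'' v) :
    ∃ S' v₁ v₂, Run k S σ S' v₁ ∧ Run k S' τ S'' v₂ ∧ v = v₁ + v₂ := by
  induction σ generalizing S v with
  | nil => exact ⟨S, 0, v, .nil S, h, by ring⟩
  | cons r σ ih =>
    cases h with
    | cons hc hr h1 h =>
      obtain ⟨S', v₁, v₂, h2, h3, rfl⟩ := ih h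
      exact ⟨S', _, v₂, .cons hc hr h1 h2, h3, by ring⟩

lemma Run.exists_schedule {k : ℕ} {σ : List M} {S S' : Finset M} {v : ℝ} (h : Run k S σ S' v) :
    ∃ F : ℕ → Finset M, KServerServes k S σ F ∧
      v = ∑ t ∈ Finset.range σ.length, kStepCost dist (F t) (F (t + 1)) := by
  induction h with
  | nil S => exact ⟨fun _ => S, ⟨rfl, fun t ht => absurd ht (by simp)⟩, by simp⟩
  | @cons S S' S'' r σ v hc hr h1 h ih =>
    obtain ⟨F, ⟨h0, hF⟩, rfl⟩ := ih
    refine ⟨fun t => Nat.casesOn t S F, ⟨rfl, fun t ht => ?_⟩, ?_⟩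
    · cases t with
      | zero => simpa [h0] using ⟨hc, hr, h1⟩
      | succ t => exact hF t (by simpa using ht)
    · rw [List.length_cons, Finset.sum_range_succ', add_comm]
      simp [h0]

lemma run_of_serves {k : ℕ} {σ : List M} {F : ℕ → Finset M} {S : Finset M}
    (h : KServerServes k S σ F) : Run k S σ (F σ.length)
      (∑ t ∈ Finset.range σ.length, kStepCost dist (F t) (F (t + 1))) := by
  induction σ generalizing F S with
  | nil => simpa [h.1] using Run.nil (k := k) S
  | cons r σ ih =>
    obtain ⟨rfl, hF⟩ := h
    rw [List.length_cons, Finset.sum_range_succ', add_comm (Finset.sum _ _)]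
    obtain ⟨h1, h2, h3⟩ := hF 0 (by simp)
    exact .cons h1 h2 h3 (ih (F := fun t => F (t + 1))
      ⟨rfl, fun t ht => hF (t + 1) (by simpa using ht)⟩)

lemma kServerOpt_le {k : ℕ} {σ : List M} {S S' : Finset M} {v : ℝ} (h : Run k S σ S' v) :
    kServerOpt dist k S σ ≤ v := by
  refine csInf_le ⟨0, ?_⟩ h.exists_schedule
  rintro _ ⟨F, -, rfl⟩
  exact Finset.sum_nonneg fun _ _ => kStepCost_nonneg _ _

lemma le_kServerOpt {k : ℕ} {σ : List M} {S : Finset M} {b : ℝ} (hne : ∃ S' v, Run k S σ S' v)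
    (h : ∀ S' v, Run k S σ S' v → b ≤ v) : b ≤ kServerOpt dist k S σ := by
  obtain ⟨S', v, hr⟩ := hne
  refine le_csInf ⟨v, hr.exists_schedule⟩ ?_
  rintro _ ⟨F, hF, rfl⟩
  exact h _ _ (run_of_serves hF)

/-- The configuration of the algorithm `A` after the request sequence `l`. -/
noncomputable def cfg (A : List M → Finset M) (S₀ : Finset M) (l : List M) : Finset M :=
  if l = [] then S₀ else A l

/-- The cost of the algorithm `A` on the requests `σ` that follow `l`. -/
noncomputable def algCost (A : List M → Finset M) (S₀ : Finset M) : List M → List M → ℝ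
  | _, [] => 0
  | l, r :: σ => kStepCost dist (cfg A S₀ l) (cfg A S₀ (l ++ [r])) + algCost A S₀ (l ++ [r]) σ

lemma sum_kStepCost_cfg (A : List M → Finset M) (S₀ : Finset M) (l σ : List M) :
    ∑ t ∈ Finset.range σ.length,
      kStepCost dist (cfg A S₀ (l ++ σ.take t)) (cfg A S₀ (l ++ σ.take (t + 1))) =
        algCost A S₀ l σ := by
  induction σ generalizing l with
  | nil => simp [algCost]
  | cons r σ ih =>
    rw [List.length_cons, Finset.sum_range_succ', algCost, ← ih, add_comm]
    simp

lemma kServerCost_eq (A : List M → Finset M) (S₀ : Finset M) (σ : List M) :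
    kServerCost dist A S₀ σ = algCost A S₀ [] σ := by
  rw [← sum_kStepCost_cfg]
  refine Finset.sum_congr rfl fun t ht => ?_
  have ht := Finset.mem_range.1 ht
  have h : ∀ t ≤ σ.length, σ ≠ [] → kConfig A S₀ σ t = cfg A S₀ ([] ++ σ.take t) :=
    fun t _ hσ => by simp [kConfig, cfg, List.take_eq_nil_iff, hσ]
  have hσ : σ ≠ [] := by rintro rfl; simp at ht
  rw [h t ht.le hσ, h (t + 1) ht hσ]

lemma algCost_append (A : List M → Finset M) (S₀ : Finset M) (l σ τ : List M) :
    algCost A S₀ l (σ ++ τ) = algCost A S₀ l σ + algCost A S₀ (l ++ σ) τ := by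
  induction σ generalizing l with
  | nil => simp [algCost]
  | cons r σ ih => simp [algCost, ih, add_assoc]

lemma algCost_nonneg (A : List M → Finset M) (S₀ : Finset M) (l σ : List M) :
    0 ≤ algCost A S₀ l σ := by
  rw [← sum_kStepCost_cfg]
  exact Finset.sum_nonneg fun _ _ => kStepCost_nonneg _ _

lemma KServerAlg.run {k : ℕ} {A : List M → Finset M} {S₀ : Finset M} (h : KServerAlg k S₀ A)
    (l σ : List M) : Run k (cfg A S₀ l) σ (cfg A S₀ (l ++ σ)) (algCost A S₀ l σ) := by
  induction σ generalizing l with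
  | nil => simpa [algCost] using Run.nil (k := k) (cfg A S₀ l)
  | cons r σ ih =>
    have e : cfg A S₀ (l ++ [r]) = A (l ++ [r]) := if_neg (by simp)
    obtain ⟨h1, h2, h3⟩ := h l r
    rw [← e] at h1 h2
    have h4 := Run.cons (S := cfg A S₀ l) h1 h2 (by rwa [e]) (ih (l ++ [r]))
    rwa [List.append_assoc, List.singleton_append] at h4

variable {k : ℕ} {N : Finset M} {δ : ℝ}

/-- The effect on the hole of requesting all points of `L`. -/
lemma Run.pass (hN : N.card = k + 1) (hδ : ∀ x ∈ N, ∀ y ∈ N, x ≠ y → δ ≤ dist x y)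
    {L : List M} (hL : ∀ y ∈ L, y ∈ N) {S S' : Finset M} {v : ℝ} (h : Run k S L S' v)
    {x : M} {m : ℝ} (hm : Matched N S x m) :
    ∃ x' m', Matched N S' x' m' ∧ dist x x' + m' ≤ v + m ∧ (x ∉ L → x' = x) ∧
      (x ∈ L → δ + m' ≤ v + m) := by
  induction h generalizing x m with
  | nil S => exact ⟨x, m, hm, by simp, fun _ => rfl, by simp⟩
  | @cons S S' S'' r σ v hc hr h1 h ih =>
    have := hm.card
    obtain ⟨x₁, hx₁, m₁, h2, h3, h4⟩ := hm.request (by omega) hr h1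
    obtain ⟨x', m', h5, h6, h7, h8⟩ := ih (fun y hy => hL y (List.mem_cons_of_mem _ hy)) h2
    refine ⟨x', m', h5, by linarith [dist_triangle x x₁ x'], fun hx => ?_, fun hx => ?_⟩
    · rw [List.mem_cons, not_or] at hx
      obtain rfl := h4 hx.1
      exact h7 hx.2
    · by_cases hxr : x = r
      · have := hδ x hm.1 x₁ h2.1 (by rw [hxr]; exact hx₁.symm)
        linarith [dist_nonneg (x := x₁) (y := x')]
      · obtain rfl := h4 hxr
        have := h8 ((List.mem_cons.1 hx).resolve_left hxr)
        rw [dist_self] at h3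
        linarith

/-- The effect on the hole of requesting all points of `L` repeatedly. -/
lemma Run.passes (hN : N.card = k + 1) (hδ : ∀ x ∈ N, ∀ y ∈ N, x ≠ y → δ ≤ dist x y)
    {L : List M} (hL : ∀ y ∈ L, y ∈ N) {K : ℕ} {S S' : Finset M} {v : ℝ}
    (h : Run k S (List.replicate K L).flatten S' v) {x : M} {m : ℝ} (hm : Matched N S x m) :
    ∃ x' m', Matched N S' x' m' ∧ dist x x' + m' ≤ v + m ∧ (x ∉ L → x' = x) ∧
      (x' ∉ L ∨ K * δ + m' ≤ v + m) := by
  induction K generalizing S v x m with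
  | zero =>
    cases h
    exact ⟨x, m, hm, by simp, fun _ => rfl, by simp⟩
  | succ K ih =>
    rw [List.replicate_succ, List.flatten_cons] at h
    obtain ⟨S₁, v₁, v₂, h1, h2, rfl⟩ := h.of_append
    obtain ⟨x₁, m₁, h3, h4, h5, h6⟩ := h1.pass hN hδ hL hm
    obtain ⟨x', m', h7, h8, h9, h10⟩ := ih h2 h3
    refine ⟨x', m', h7, by linarith [dist_triangle x x₁ x'], fun hx => ?_, ?_⟩
    · obtain rfl := h5 hx
      exact h9 hx
    · by_cases hx : x ∈ L
      · rcases h10 with h10 | h10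
        · exact .inl h10
        · right
          have := h6 hx
          push_cast
          linarith
      · obtain rfl := h5 hx
        rw [h9 hx]
        exact .inl hx

/-- The effect of a request to `y` followed by sufficiently many requests to all points outside
`Y`. -/
lemma Run.task (hN : N.card = k + 1) (hδ : ∀ x ∈ N, ∀ y ∈ N, x ≠ y → δ ≤ dist x y)
    {D : ℝ} (hD : ∀ x ∈ N, ∀ y ∈ N, dist x y ≤ D) {K : ℕ} (hK : 2 * D ≤ K * δ)
    {Y : Finset M} {L : List M} (hL : ∀ y, y ∈ L ↔ y ∈ N ∧ y ∉ Y) {y y' : M}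
    (hyN : y ∈ N) (hy'N : y' ∈ N) (hy' : ∀ z ∈ N, z ≠ y → dist y y' ≤ dist y z)
    {S S' : Finset M} {v : ℝ} (h : Run k S (y :: (List.replicate K L).flatten) S' v)
    {x : M} (hx : x ∈ Y) {m : ℝ} (hm : Matched N S x m) :
    ∃ x₁ ∈ Y, ∃ m₁, Matched N S' x₁ m₁ ∧ (x ≠ y → x₁ = x ∧ m₁ ≤ v + m) ∧
      (x = y → dist y x₁ + m₁ ≤ v + m ∧ dist y y' + m₁ ≤ v + m) := by
  cases h with
  | @cons _ S₁ _ _ _ v hc hr h1 h =>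
  have hcard := hm.card
  obtain ⟨x₁, hx₁, m₁, h2, h3, h4⟩ := hm.request (by omega) hr h1
  obtain ⟨x₂, m₂, h5, h6, h7, h8⟩ := h.passes hN hδ (fun z hz => ((hL z).1 hz).1) h2
  have hxL : x ∉ L := fun hxL => ((hL x).1 hxL).2 hx
  by_cases hxy : x = y
  · subst hxy
    have hd := hy' x₁ h2.1 hx₁
    by_cases hx₂ : x₂ ∈ L
    · have h8 := h8.resolve_left (not_not.2 hx₂)
      have e1 := hD x₂ h5.1 x hyN
      have e2 := hD x hyN y' hy'N
      have e3 := dist_nonneg (x := x) (y := x₁)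
      refine ⟨x, hx, _, h5.move_hole hyN, fun h => absurd rfl h, fun _ => ⟨?_, ?_⟩⟩
      · rw [dist_self]
        linarith [dist_nonneg (x := x) (y := y')]
      · linarith
    · have hx₂Y : x₂ ∈ Y := by
        by_contra hcon
        exact hx₂ ((hL x₂).2 ⟨h5.1, hcon⟩)
      refine ⟨x₂, hx₂Y, m₂, h5, fun h => absurd rfl h, fun _ => ⟨?_, ?_⟩⟩
      · linarith [dist_triangle x x₁ x₂]
      · linarith [dist_nonneg (x := x₁) (y := x₂)]
  · obtain rfl := h4 hxy
    obtain rfl := h7 hxL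
    rw [dist_self] at h3 h6
    exact ⟨x₂, hx, m₂, h5, fun _ => ⟨rfl, by linarith⟩, fun h => absurd h hxy⟩

end runs

section hardSequences

variable {M : Type u}

/-- Replaces each task at `y` by, with probability `pr y`, a request to `y` followed by `pins`. -/
noncomputable def hard {Y : Finset M} (pr : Y → unitInterval) (pins : List M) :
    List Y → FinDist (List M)
  | [] => FinDist.pure []
  | y :: R => (FinDist.bern (pr y)).bind fun b =>
      (hard pr pins R).map fun σ => (if b then (y : M) :: pins else []) ++ σ

lemma mem_of_mem_hard {Y N : Finset M} (hYN : Y ⊆ N) {pr : Y → unitInterval} {pins : List M}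
    (hpins : ∀ r ∈ pins, r ∈ N) (R : List Y) (i : (hard pr pins R).ι) :
    ∀ r ∈ (hard pr pins R).val i, r ∈ N := by
  induction R with
  | nil => intro r hr; exact absurd hr List.not_mem_nil
  | cons y R ih =>
    obtain ⟨b, i⟩ := i
    intro r hr
    rcases List.mem_append.1 (show r ∈ (if (FinDist.bern (pr y)).val b then (y : M) :: pins
      else []) ++ (hard pr pins R).val i from hr) with hr | hr
    · split_ifs at hr
      · rcases List.mem_cons.1 hr with rfl | hr
        · exact hYN y.2
        · exact hpins r hr
      · exact absurd hr List.not_mem_nil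
    · exact ih i r hr

lemma nonempty_erase {N : Finset M} (hN : 1 < N.card) (r : M) : Nonempty {x // x ∈ N.erase r} := by
  obtain ⟨x, hx, hxr⟩ := Finset.exists_mem_ne hN r
  exact ⟨⟨x, Finset.mem_erase.2 ⟨hxr, hx⟩⟩⟩

variable [MetricSpace M]

lemma value_le_expect_algCost {k : ℕ} {c : ℝ} {N Y : Finset M} [Nonempty Y]
    {pr : Y → unitInterval} {pins : List M} {η : Y → ℝ} (hη : ∀ y, pr y * η y = c)
    (htask : ∀ (y : Y) (S S' : Finset M) (v : ℝ), Run k S (y :: pins) S' v →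
      ∀ x ∈ Y, ∀ m, Matched N S x m → ∃ x₁ ∈ Y, ∃ m₁, Matched N S' x₁ m₁ ∧
        (x ≠ y → x₁ = x ∧ m₁ ≤ v + m) ∧
        (x = y → dist (y : M) x₁ + m₁ ≤ v + m ∧ η y + m₁ ≤ v + m))
    {A : List M → Finset M} {S₀ : Finset M} (hA : KServerAlg k S₀ A) {α : Type*}
    (t : ReqTree Y α) (l : List M) (x : Y) {m : ℝ} (hm : Matched N (cfg A S₀ l) x m) :
    t.value c (fun _ _ => 0) x / 2 ≤
      (t.law.expect fun z => (hard pr pins z.1).expect (algCost A S₀ l)) + m := by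
  induction t generalizing l x m with
  | ret a => simpa [ReqTree.value, ReqTree.law, hard, algCost] using hm.nonneg
  | task y t ih =>
    obtain ⟨x₁, hx₁, m₁, h1, h2, h3⟩ := htask y _ _ _ (hA.run l (y :: pins)) x x.2 m hm
    have i1 := ih l x hm
    have i2 := ih (l ++ (y : M) :: pins) ⟨x₁, hx₁⟩ h1
    have hp0 := (pr y).2.1
    have hp1 := (pr y).2.2
    simp only [ReqTree.law, hard, FinDist.expect_map, FinDist.expect_bind, FinDist.expect_bern,
      if_true, Bool.false_eq_true, if_false, List.nil_append, FinDist.expect_add,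
      FinDist.expect_const_mul]
    simp only [algCost_append, FinDist.expect_add, FinDist.expect_const]
    have hv := ReqTree.value_task_le c y t (fun _ _ => 0) x x
    rw [dist_self, zero_add] at hv
    have hl := ReqTree.value_lipschitz c t (f := fun _ _ => 0)
      (fun _ _ _ => by simp [dist_nonneg]) x ⟨x₁, hx₁⟩
    have hy := hη y
    generalize (t.law.expect fun z => (hard pr pins z.1).expect (algCost A S₀ l)) = F at *
    generalize (t.law.expect fun z =>
      (hard pr pins z.1).expect (algCost A S₀ (l ++ (y : M) :: pins))) = F' at *
    generalize algCost A S₀ l (y :: pins) = v at *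
    have key : (t.value c (fun _ _ => 0) x + if x = y then η y else 0) / 2 ≤ v + F' + m := by
      split_ifs with hxy
      · obtain ⟨h4, h5⟩ := h3 (by rw [hxy])
        rw [← hxy] at h4
        have : dist x ⟨x₁, hx₁⟩ = dist (x : M) x₁ := rfl
        linarith
      · obtain ⟨rfl, h4⟩ := h2 fun h => hxy (Subtype.ext h)
        linarith
    have e1 := mul_le_mul_of_nonneg_left key hp0
    have e2 := mul_le_mul_of_nonneg_left i1 (sub_nonneg.2 hp1)
    split_ifs at key hv e1 <;> nlinarith
  | coin p t ih =>
    have e1 := mul_le_mul_of_nonneg_left (ih true l x hm) p.2.1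
    have e2 := mul_le_mul_of_nonneg_left (ih false l x hm) (sub_nonneg.2 p.2.2)
    simp only [ReqTree.value, ReqTree.law, FinDist.expect_bind, FinDist.expect_bern]
    linarith

/-- The cost of the best offline way to keep the hole, initially at a given point, away from the
requests inside `N`. -/
noncomputable def holeCost (N : Finset M) : List M → M → ℝ
  | [], _ => 0
  | r :: σ, a => ⨅ x : {x // x ∈ N.erase r}, (dist a x + holeCost N σ x)

variable {N : Finset M}

lemma holeCost_cons_le {r x : M} (hx : x ∈ N) (hxr : x ≠ r) (σ : List M) (a : M) :
    holeCost N (r :: σ) a ≤ dist a x + holeCost N σ x :=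
  ciInf_le (Set.finite_range _).bddBelow (⟨x, Finset.mem_erase.2 ⟨hxr, hx⟩⟩ : {x // x ∈ N.erase r})

lemma holeCost_le_dist_add (hN : 1 < N.card) (σ : List M) (a b : M) :
    holeCost N σ a ≤ dist a b + holeCost N σ b := by
  cases σ with
  | nil => simp [holeCost, dist_nonneg]
  | cons r σ =>
    have := nonempty_erase hN r
    rw [← sub_le_iff_le_add']
    refine le_ciInf fun x => ?_
    obtain ⟨hxr, hx⟩ := Finset.mem_erase.1 x.2
    have := holeCost_cons_le hx hxr σ a
    linarith [dist_triangle a b x]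

lemma holeCost_append_le_of_notMem {x : M} (hx : x ∈ N) {τ : List M} (hτ : x ∉ τ) (σ : List M) :
    holeCost N (τ ++ σ) x ≤ holeCost N σ x := by
  induction τ with
  | nil => rfl
  | cons r τ ih =>
    rw [List.mem_cons, not_or] at hτ
    have := holeCost_cons_le hx hτ.1 (τ ++ σ) x
    rw [dist_self, zero_add] at this
    exact this.trans (ih hτ.2)

lemma holeCost_append_le (hN : 1 < N.card) {D : ℝ} (hD : ∀ x ∈ N, ∀ y ∈ N, dist x y ≤ D)
    (σ τ : List M) {a : M} (ha : a ∈ N) :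
    holeCost N (σ ++ τ) a ≤ holeCost N σ a + τ.length * D := by
  induction σ generalizing a with
  | nil =>
    rw [List.nil_append, holeCost, zero_add]
    induction τ generalizing a with
    | nil => simp [holeCost]
    | cons r τ ih =>
      obtain ⟨x, hx, hxr⟩ := Finset.exists_mem_ne hN r
      have := holeCost_cons_le hx hxr τ a
      push_cast [List.length_cons]
      linarith [ih hx, hD a ha x hx]
  | cons r σ ih =>
    have := nonempty_erase hN r
    rw [← sub_le_iff_le_add]
    refine le_ciInf fun x => ?_
    obtain ⟨hxr, hx⟩ := Finset.mem_erase.1 x.2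
    have := holeCost_cons_le hx hxr (σ ++ τ) a
    rw [List.cons_append]
    linarith [ih hx]

lemma exists_run_holeCost {k : ℕ} (hk : 1 ≤ k) (hN : N.card = k + 1) {σ : List M}
    (hσ : ∀ r ∈ σ, r ∈ N) {a : M} (ha : a ∈ N) :
    ∃ S', Run k (N.erase a) σ S' (holeCost N σ a) := by
  induction σ generalizing a with
  | nil => exact ⟨_, .nil _⟩
  | cons r σ ih =>
    have := nonempty_erase (N := N) (by omega) r
    obtain ⟨⟨x, hx'⟩, h⟩ := exists_eq_ciInf_of_finite
      (f := fun x : {x // x ∈ N.erase r} => dist a x + holeCost N σ x)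
    obtain ⟨hxr, hx⟩ := Finset.mem_erase.1 hx'
    obtain ⟨S', hS'⟩ := ih (fun r hr => hσ r (List.mem_cons_of_mem _ hr)) hx
    have e : ∀ a x : M, x ∈ N → a ≠ x → N.erase a \ N.erase x = {x} := by
      intro a x hx hax
      ext z
      simp only [Finset.mem_sdiff, Finset.mem_erase, Finset.mem_singleton]
      constructor
      · rintro ⟨h1, h2⟩
        by_contra hzx
        exact h2 ⟨hzx, h1.2⟩
      · rintro rfl
        exact ⟨⟨Ne.symm hax, hx⟩, fun h => h.1 rfl⟩
    have hcost : kStepCost dist (N.erase a) (N.erase x) = dist a x := by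
      by_cases hax : a = x
      · simp [hax, kStepCost]
      · rw [kStepCost, e a x hx hax, e x a ha (Ne.symm hax)]
        simp [dist_comm]
    refine ⟨S', ?_⟩
    rw [holeCost, ← h, ← hcost]
    refine .cons ?_ (Finset.mem_erase.2 ⟨Ne.symm hxr, hσ r (by simp)⟩) ?_ hS'
    · rw [Finset.card_erase_of_mem hx, hN, Nat.add_sub_cancel]
    · by_cases hax : a = x
      · simp [hax]
      · simp [e x a ha (Ne.symm hax)]

lemma expect_holeCost_le (hN : 1 < N.card) {c : ℝ} {Y : Finset M} [Nonempty Y] (hYN : Y ⊆ N)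
    {pr : Y → unitInterval} {pins : List M} (hpins : ∀ y ∈ Y, y ∉ pins) {nn : Y → M}
    (hnnN : ∀ y, nn y ∈ N) (hnn : ∀ y, nn y ≠ y) (hpr : ∀ y : Y, pr y * dist (y : M) (nn y) = c)
    (R : List Y) (a b : Y) :
    ((hard pr pins R).expect fun σ => holeCost N σ a) ≤ 2 * off c R a b := by
  induction R generalizing a with
  | nil => simp [hard, holeCost, off, dist_nonneg]
  | cons y R ih =>
    rw [mul_comm, ← div_le_iff₀ two_pos]
    refine le_ciInf fun x => ?_
    rw [div_le_iff₀ two_pos]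
    have h1 : ∀ σ, (pr y : ℝ) * holeCost N ((y : M) :: pins ++ σ) a + (1 - pr y) * holeCost N σ a ≤
        dist a x + (if x = y then 2 * c else 0) + holeCost N σ x := by
      intro σ
      have e1 : holeCost N σ a ≤ dist a x + holeCost N σ x := holeCost_le_dist_add hN σ a x
      have e2 : holeCost N ((y : M) :: pins ++ σ) a ≤
          dist a x + (if x = y then 2 * dist (y : M) (nn y) else 0) + holeCost N σ x := by
        rw [List.cons_append]
        split_ifs with hxy
        · subst hxy
          have e3 := holeCost_cons_le (hnnN x) (hnn x) (pins ++ σ) a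
          have e4 := holeCost_le_dist_add hN (pins ++ σ) (nn x) x
          have e5 := holeCost_append_le_of_notMem (hYN x.2) (hpins x x.2) σ
          have e6 := dist_triangle (a : M) x (nn x)
          rw [dist_comm (nn x) (x : M)] at e4
          have : dist a x = dist (a : M) x := rfl
          linarith
        · have e3 := holeCost_cons_le (hYN x.2) (fun h => hxy (Subtype.ext h)) (pins ++ σ) a
          have e5 := holeCost_append_le_of_notMem (hYN x.2) (hpins x x.2) σ
          have : dist a x = dist (a : M) x := rfl
          linarith
      have e3 := mul_le_mul_of_nonneg_left e1 (sub_nonneg.2 (pr y).2.2)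
      have e4 := mul_le_mul_of_nonneg_left e2 (pr y).2.1
      have := hpr y
      split_ifs at e4 ⊢ <;> nlinarith
    simp only [hard, FinDist.expect_bind, FinDist.expect_map, FinDist.expect_bern, if_true,
      Bool.false_eq_true, if_false, List.nil_append]
    rw [← FinDist.expect_const_mul, ← FinDist.expect_const_mul, ← FinDist.expect_add]
    refine (FinDist.expect_mono _ h1).trans ?_
    rw [FinDist.expect_add, FinDist.expect_const]
    have := ih x
    have hd := dist_nonneg (x := a) (y := x)
    split_ifs <;> linarith

end hardSequences

lemma Good.exists_trees {M : Type u} [MetricSpace M] [Finite M] [Nonempty M] [Fintype M]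
    {c g Q r : ℝ} (h : Good c (Finset.univ : Finset M) g Q r) {D : ℝ}
    (hD : ∀ x y : M, dist x y ≤ D) :
    ∃ (S : Type) (init : FinDist S) (t : S → ReqTree M S),
      (∀ s x, g ≤ (t s).value c (fun _ _ => 0) x) ∧
      ∀ x, (init.expect fun s => (t s).law.expect fun z => off c z.1 x x) ≤ r + 2 * D := by
  obtain ⟨S, step, hd, hJ⟩ := h
  obtain ⟨init, α, E, R, q, hlaw, -, -, hr⟩ := hJ 1
  refine ⟨S, init, step, fun s x => ?_, fun x => ?_⟩
  · simpa using hd s (fun _ => 0) (by simp [dist_nonneg]) (by simp)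
      (fun x _ z hz => absurd (Finset.mem_univ z) hz) x
  · have h1 := hlaw fun F => off c (F 0) x x
    simp only [ReqTree.rounds, FinDist.expect_bind, FinDist.expect_map, FinDist.expect_pure,
      ReqTree.consF] at h1
    rw [h1]
    have h2 : ∀ ω, off c (R ω 0) x x ≤ off c (R ω 0) (q ω 0) (q ω 1) + 2 * D := fun ω => by
      have e1 := off_le_dist_add c (R ω 0) x (q ω 0) x
      have e2 := off_append_le c (R ω 0) [] (q ω 0) (q ω 1) x
      rw [List.append_nil] at e2
      have e3 : off c [] (q ω 1) x ≤ D := hD _ _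
      linarith [hD x (q ω 0)]
    have h3 := E.expect_mono h2
    rw [FinDist.expect_add, FinDist.expect_const] at h3
    linarith [hr 0 one_pos]

lemma FinDist.expect_mono_val {α : Type*} (D : FinDist α) {φ ψ : α → ℝ}
    (h : ∀ i, φ (D.val i) ≤ ψ (D.val i)) : D.expect φ ≤ D.expect ψ :=
  Finset.sum_le_sum fun i _ => mul_le_mul_of_nonneg_left (h _) (D.nonneg i)

lemma kServerDLB_of_finDist {M : Type u} {d : M → M → ℝ} {k : ℕ} {S₀ : Finset M} {C : ℝ}
    (h : ∀ B : ℝ, 0 ≤ B → ∃ D : FinDist (List M), B ≤ D.expect (kServerOpt d k S₀) ∧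
      ∀ A : List M → Finset M, KServerAlg k S₀ A →
        C * D.expect (kServerOpt d k S₀) ≤ D.expect (kServerCost d A S₀)) :
    KServerDLB d k S₀ C := by
  intro B hB
  obtain ⟨D, h1, h2⟩ := h B hB
  have e : ∀ φ : List M → ℝ, ∑ i, D.w ((Fintype.equivFin D.ι).symm i) *
      φ (D.val ((Fintype.equivFin D.ι).symm i)) = D.expect φ := fun φ =>
    Equiv.sum_comp (Fintype.equivFin D.ι).symm fun i => D.w i * φ (D.val i)
  refine ⟨Fintype.card D.ι, fun i => D.w ((Fintype.equivFin D.ι).symm i),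
    fun i => D.val ((Fintype.equivFin D.ι).symm i), fun _ => D.nonneg _, ?_, ?_, fun A hA => ?_⟩
  · rw [Equiv.sum_comp (Fintype.equivFin D.ι).symm D.w, D.sum_one]
  · rwa [e]
  · rw [e, e]
    exact h2 A hA

section lowerBound

variable {M : Type u} [MetricSpace M]

lemma le_kServerOpt_append {k K : ℕ} {N : Finset M} {δ : ℝ} (hk : 1 ≤ k) (hN : N.card = k + 1)
    (hδ : ∀ x ∈ N, ∀ y ∈ N, x ≠ y → δ ≤ dist x y) {x : M} (hx : x ∈ N) {σ : List M}
    (hσ : ∀ r ∈ σ, r ∈ N) :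
    K * δ ≤ kServerOpt dist k (N.erase x) (σ ++ (List.replicate K N.toList).flatten) := by
  refine le_kServerOpt ?_ fun S' v h => ?_
  · obtain ⟨S', h⟩ := exists_run_holeCost hk hN (σ := σ ++ (List.replicate K N.toList).flatten)
      (fun r hr => (List.mem_append.1 hr).elim (hσ r) fun hr => by
        obtain ⟨L, hL, hr⟩ := List.mem_flatten.1 hr
        rw [List.eq_of_mem_replicate hL] at hr
        exact Finset.mem_toList.1 hr) hx
    exact ⟨S', _, h⟩
  · obtain ⟨S₁, v₁, v₂, h1, h2, rfl⟩ := h.of_append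
    obtain ⟨x₁, m₁, h3, h4, -⟩ := h1.pass hN hδ hσ (matched_erase hx)
    obtain ⟨x₂, m₂, h5, -, -, h6⟩ := h2.passes hN hδ (fun y hy => Finset.mem_toList.1 hy) h3
    have h6 := h6.resolve_left (not_not.2 (Finset.mem_toList.2 h5.1))
    linarith [h5.nonneg, dist_nonneg (x := x) (y := x₁)]

lemma exists_pos_lt_dist [Finite M] : ∃ Δ > 0, ∀ x y : M, x ≠ y → Δ < dist x y := by
  have := Fintype.ofFinite M
  rcases (Finset.univ.filter fun z : M × M => z.1 ≠ z.2).eq_empty_or_nonempty with h | h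
  · refine ⟨1, one_pos, fun x y hxy => ?_⟩
    have := h ▸ Finset.mem_filter.2 ⟨Finset.mem_univ (x, y), hxy⟩
    exact absurd this (Finset.notMem_empty _)
  · obtain ⟨z, hz, hmin⟩ := Finset.exists_min_image _ (fun z : M × M => dist z.1 z.2) h
    have hpos := dist_pos.2 (Finset.mem_filter.1 hz).2
    refine ⟨dist z.1 z.2 / 2, half_pos hpos, fun x y hxy => ?_⟩
    have := hmin (x, y) (Finset.mem_filter.2 ⟨Finset.mem_univ _, hxy⟩)
    dsimp only at this
    linarith

lemma exists_kServerDLB [Finite M] {a : ℝ} (ha : 0 < a) (ha₁ : a ≤ Real.exp (-2100) / 8400)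
    {k : ℕ} (hk : 2 ≤ k) {N : Finset M} (hN : N.card = k + 1) :
    ∃ x ∈ N, KServerDLB dist k (N.erase x) (a / 16 * Real.log k) := by
  obtain ⟨Δ, hΔ, hmin⟩ := exists_pos_lt_dist (M := M)
  obtain ⟨D, hD⟩ : ∃ D : ℝ, ∀ x y : M, dist x y ≤ D := by
    obtain ⟨D, hD⟩ := (Set.finite_range fun z : M × M => dist z.1 z.2).bddAbove
    exact ⟨D, fun x y => hD ⟨(x, y), rfl⟩⟩
  have hN1 : 1 < N.card := by omega
  obtain ⟨Y, hYN, hY, hcard, g, Q, hg, hgQ, hgood⟩ := exists_good_subset ha.le ha₁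
    (show 0 < Δ / 32 by positivity) (fun x y hxy => by linarith [hmin x y hxy])
    (Finset.card_pos.1 (by omega : 0 < N.card))
  have := hY.to_subtype
  obtain ⟨x₀, hx₀⟩ := hY
  have hD0 : 0 ≤ D := dist_nonneg.trans (hD x₀ x₀)
  have hδ : ∀ x ∈ N, ∀ y ∈ N, x ≠ y → Δ ≤ dist x y := fun x _ y _ hxy => (hmin x y hxy).le
  choose nn hnnN hnn using fun y : Y => Finset.exists_min_image (N.erase y) (dist (y : M))
    ((nonempty_erase hN1 (y : M)).elim fun z => ⟨z, z.2⟩)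
  have hnn0 : ∀ y : Y, Δ < dist (y : M) (nn y) := fun y =>
    hmin _ _ (Ne.symm (Finset.ne_of_mem_erase (hnnN y)))
  set c := Δ / 32 / 4 with hc
  have hpr : ∀ y : Y, ∃ p : unitInterval, p * dist (y : M) (nn y) = c := fun y => by
    have hpos := hΔ.trans (hnn0 y)
    exact ⟨⟨c / dist (y : M) (nn y), by positivity, by
      rw [div_le_one hpos]; linarith [hnn0 y]⟩, div_mul_cancel₀ _ hpos.ne'⟩
  choose pr hpr using hpr
  obtain ⟨K, hK⟩ := exists_nat_ge (2 * D / Δ)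
  rw [div_le_iff₀ hΔ] at hK
  have hL : ∀ y, y ∈ (N \ Y).toList ↔ y ∈ N ∧ y ∉ Y := by simp
  set pins := (List.replicate K (N \ Y).toList).flatten with hpins
  have hmem : ∀ r ∈ pins, r ∈ N ∧ r ∉ Y := fun r hr => by
    obtain ⟨L, hL', hr⟩ := List.mem_flatten.1 hr
    rw [List.eq_of_mem_replicate hL'] at hr
    exact (hL r).1 hr
  refine ⟨x₀, hYN hx₀, kServerDLB_of_finDist fun B _ => ?_⟩
  obtain ⟨K', hK'⟩ := exists_nat_ge (B / Δ)
  rw [div_le_iff₀ hΔ] at hK'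
  set τ := (List.replicate K' N.toList).flatten with hτ
  set L := 1 + a * Real.log Y.card with hLdef
  have hY1 : (1 : ℝ) ≤ Y.card := by exact_mod_cast Finset.card_pos.2 ⟨x₀, hx₀⟩
  have hlogY := Real.log_nonneg hY1
  have hL0 : 0 < L := by positivity
  have hlogk : 0 ≤ Real.log k := Real.log_nonneg (by exact_mod_cast (by omega : 1 ≤ k))
  set C := a / 16 * Real.log k with hC
  have hC0 : 0 ≤ C := by positivity
  have hCL : C ≤ L / 8 := by
    have h1 : Real.log k ≤ 2 * Real.log Y.card := by
      have hk0 : (0 : ℝ) < k := by exact_mod_cast (by omega : 0 < k)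
      have h2 : (k : ℝ) ≤ N.card := by exact_mod_cast (by omega : k ≤ N.card)
      have h3 := Real.log_le_log hk0 h2
      have h4 := Real.log_le_log (Real.sqrt_pos.2 (hk0.trans_le h2)) hcard
      rw [Real.log_sqrt (by positivity)] at h4
      linarith
    have := mul_le_mul_of_nonneg_left h1 ha.le
    rw [hC, hLdef]
    linarith
  obtain ⟨n, hn⟩ := exists_nat_ge (4 * (C * (4 * D + τ.length * D)) / g)
  rw [div_le_iff₀ hg] at hn
  obtain ⟨S, init, t, hval, hoff⟩ := (hgood.iter hg.le hgQ n (Q' := Q + n * g)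
    (by linarith)).exists_trees fun x y => hD x y
  set μ := init.bind fun s => (t s).law.bind fun z => hard pr pins z.1 with hμ
  have hμN : ∀ i, ∀ r ∈ μ.val i, r ∈ N := fun i =>
    mem_of_mem_hard hYN (fun r hr => (hmem r hr).1) _ i.2.2
  refine ⟨μ.map (· ++ τ), ?_, fun A hA => ?_⟩
  · rw [FinDist.expect_map]
    refine le_trans ?_ (μ.expect_mono_val (φ := fun _ => K' * Δ) fun i =>
      le_kServerOpt_append (by omega) hN hδ (hYN hx₀) (hμN i))
    rwa [FinDist.expect_const]
  · rw [FinDist.expect_map, FinDist.expect_map]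
    have hopt : (μ.expect fun σ => kServerOpt dist k (N.erase x₀) (σ ++ τ)) ≤
        2 * (n * (g / L) + 2 * D) + τ.length * D := by
      have h1 : (μ.expect fun σ => kServerOpt dist k (N.erase x₀) (σ ++ τ)) ≤
          μ.expect fun σ => holeCost N σ x₀ + τ.length * D := by
        refine μ.expect_mono_val fun i => ?_
        obtain ⟨S', h⟩ := exists_run_holeCost (by omega) hN (σ := μ.val i ++ τ)
          (fun r hr => (List.mem_append.1 hr).elim (hμN i r) fun hr => by
            obtain ⟨L, hL, hr⟩ := List.mem_flatten.1 hr
            rw [List.eq_of_mem_replicate hL] at hr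
            exact Finset.mem_toList.1 hr) (hYN hx₀)
        exact (kServerOpt_le h).trans
          (holeCost_append_le hN1 (fun x _ y _ => hD x y) _ _ (hYN hx₀))
      have h2 : (μ.expect fun σ => holeCost N σ x₀) ≤ 2 * (init.expect fun s =>
          (t s).law.expect fun z => off c z.1 ⟨x₀, hx₀⟩ ⟨x₀, hx₀⟩) := by
        rw [hμ, FinDist.expect_bind, ← FinDist.expect_const_mul]
        refine init.expect_mono fun s => ?_
        rw [FinDist.expect_bind, ← FinDist.expect_const_mul]
        exact (t s).law.expect_mono fun z => expect_holeCost_le hN1 hYN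
          (fun y hy hyp => (hmem y hyp).2 hy) (fun y => Finset.mem_of_mem_erase (hnnN y))
          (fun y => Finset.ne_of_mem_erase (hnnN y)) hpr z.1 ⟨x₀, hx₀⟩ ⟨x₀, hx₀⟩
      rw [FinDist.expect_add, FinDist.expect_const] at h1
      linarith [hoff ⟨x₀, hx₀⟩]
    have halg : n * g / 2 ≤ μ.expect fun σ => kServerCost dist A (N.erase x₀) (σ ++ τ) := by
      have h1 : ∀ s, n * g / 2 ≤ (t s).law.expect fun z =>
          (hard pr pins z.1).expect (algCost A (N.erase x₀) []) := fun s => by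
        have h2 := value_le_expect_algCost (N := N) (pins := pins)
          (η := fun y => dist (y : M) (nn y)) hpr
          (fun y S S' v h x hx m hm => h.task hN hδ (fun x _ y _ => hD x y) hK hL (hYN y.2)
            (Finset.mem_of_mem_erase (hnnN y))
            (fun z hz hzy => hnn y z (Finset.mem_erase.2 ⟨hzy, hz⟩)) hx hm)
          hA (t s) [] ⟨x₀, hx₀⟩ (m := 0) (by simpa [cfg] using matched_erase (hYN hx₀))
        linarith [hval s ⟨x₀, hx₀⟩]
      have h2 := init.expect_mono h1
      rw [FinDist.expect_const] at h2
      have h3 : (init.expect fun s => (t s).law.expect fun z =>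
          (hard pr pins z.1).expect (algCost A (N.erase x₀) [])) =
          μ.expect (algCost A (N.erase x₀) []) := by
        simp only [hμ, FinDist.expect_bind]
      rw [h3] at h2
      refine h2.trans (μ.expect_mono fun σ => ?_)
      rw [kServerCost_eq, algCost_append]
      linarith [algCost_nonneg A (N.erase x₀) ([] ++ σ) τ]
    have h1 := mul_le_mul_of_nonneg_left hopt hC0
    have h2 : C * (n * (g / L)) ≤ n * g / 8 := by
      have : 0 ≤ n * (g / L) := by positivity
      calc C * (n * (g / L)) ≤ L / 8 * (n * (g / L)) := mul_le_mul_of_nonneg_right hCL this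
        _ = n * g / 8 := by field_simp
    refine le_trans ?_ halg
    linarith

end lowerBound

/-- There is an absolute constant `c > 0` such that for all
`k ≥ 2` and every metric space on `n > k` points, there is an initial
configuration of `k` servers for which `c·log k` is a distributional lower
bound for the `k`-server problem. -/
theorem kserver_universal_log_lower_bound :
    ∃ c : ℝ, 0 < c ∧ ∀ k n : ℕ, 2 ≤ k → k < n →
      ∀ (M : Type u) (d : M → M → ℝ), Finite M → Nat.card M = n → IsMetric d →
        ∃ S₀ : Finset M, S₀.card = k ∧ KServerDLB d k S₀ (c * Real.log k) := by
  refine ⟨Real.exp (-2100) / 8400 / 16, by positivity, fun k n hk hkn M d _ hcard hd => ?_⟩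
  let _ : MetricSpace M :=
    { dist := d
      dist_self := fun x => (hd.1 x x).2 rfl
      dist_comm := hd.2.1
      dist_triangle := hd.2.2
      eq_of_dist_eq_zero := fun {x y} h => (hd.1 x y).1 h }
  have := Fintype.ofFinite M
  obtain ⟨N, -, hN⟩ := Finset.exists_subset_card_eq (s := (Finset.univ : Finset M)) (n := k + 1)
    (by rw [Finset.card_univ, ← Nat.card_eq_fintype_card, hcard]; exact hkn)
  obtain ⟨x, hx, h⟩ := exists_kServerDLB (M := M) (by positivity) le_rfl hk hN
  exact ⟨N.erase x, by rw [Finset.card_erase_of_mem hx, hN, Nat.add_sub_cancel], h⟩
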